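/- Let V be an optimal computer and let T be a computable real with 0 < T < 1. Then the energy E_V(T) = Z_V(T)^{−1} Σ_{p ∈ Dom V} |p| 2^{−|p|/T} is a well-defined real (both series converge) that is Chaitin T-random and T-compressible. -/

import Mathlib

open Filter Topology

/-- A set of finite binary strings is prefix-free if no string in it is a
proper prefix of another string in it. -/
def PrefixFree (S : Set (List Bool)) : Prop :=
  ∀ p ∈ S, ∀ q ∈ S, p <+: q → p = q

/-- A computer: a partial recursive function from finite binary strings to
finite binary strings whose domain is a nonempty prefix-free set. -/
structure Computer where
  f : List Bool →. List Bool
  partrec : Partrec f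
  dom_nonempty : f.Dom.Nonempty
  dom_prefixFree : PrefixFree f.Dom

/-- A computer `U` is optimal if for each computer `C` there is `d ∈ ℕ` such
that every `p ∈ Dom C` admits `q` with `U(q) = C(p)` and `|q| ≤ |p| + d`. -/
def Optimal (U : Computer) : Prop :=
  ∀ C : Computer, ∃ d : ℕ, ∀ p ∈ C.f.Dom,
    ∃ q : List Bool, U.f q = C.f p ∧ q.length ≤ p.length + d

/-- `H_C(s)`: the length of a shortest program for `C` printing `s`. -/
noncomputable def complexity (C : Computer) (s : List Bool) : ℕ :=
  sInf {n | ∃ p : List Bool, s ∈ C.f p ∧ p.length = n}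

/-- The `i`-th bit (for `i = 0, 1, 2, …`) of the base-two expansion of
`α - ⌊α⌋` with infinitely many zeros. -/
noncomputable def bitOf (α : ℝ) (i : ℕ) : Bool :=
  decide (⌊(α - ⌊α⌋) * 2 ^ (i + 1)⌋ % 2 = 1)

/-- `α↾n`: the first `n` bits of the base-two expansion of `α - ⌊α⌋`
with infinitely many zeros. -/
noncomputable def firstBits (α : ℝ) (n : ℕ) : List Bool :=
  (List.range n).map (bitOf α)

/-- A real `α` is computable if some total recursive `f : ℕ⁺ → ℚ` satisfies
`|α - f n| < 1/n` for all `n ≥ 1`. -/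
def ComputableReal (α : ℝ) : Prop :=
  ∃ f : ℕ → ℚ, Computable f ∧ ∀ n : ℕ, 0 < n → |α - (f n : ℝ)| < 1 / n

/-- `α` is weakly Chaitin `T`-random (w.r.t. the computer `U`). -/
def WeaklyChaitinTRandom (U : Computer) (T α : ℝ) : Prop :=
  ∃ c : ℕ, ∀ n : ℕ, 0 < n → T * n - c ≤ (complexity U (firstBits α n) : ℝ)

/-- `α` is Chaitin `T`-random (w.r.t. the computer `U`). -/
def ChaitinTRandom (U : Computer) (T α : ℝ) : Prop :=
  Tendsto (fun n : ℕ => (complexity U (firstBits α n) : ℝ) - T * n) atTop atTop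

/-- `α` is `T`-compressible (w.r.t. the computer `U`): `H(α↾n) ≤ Tn + o(n)`. -/
def TCompressible (U : Computer) (T α : ℝ) : Prop :=
  ∃ g : ℕ → ℝ, Tendsto (fun n : ℕ => g n / n) atTop (nhds 0) ∧
    ∀ n : ℕ, 0 < n → (complexity U (firstBits α n) : ℝ) ≤ T * n + g n

/-- The Boltzmann factor `2^(-|p|/T)` of a program `p`. -/
noncomputable def boltzmann (T : ℝ) (p : List Bool) : ℝ :=
  (2 : ℝ) ^ (-(p.length : ℝ) / T)

/-- Partition function `Z_C(T) = Σ_{p ∈ Dom C} 2^(-|p|/T)`. -/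
noncomputable def Zfun (C : Computer) (T : ℝ) : ℝ :=
  ∑' p : C.f.Dom, boltzmann T p.1

/-- Free energy `F_C(T) = -T log₂ Z_C(T)`. -/
noncomputable def Ffun (C : Computer) (T : ℝ) : ℝ :=
  -T * Real.logb 2 (Zfun C T)

/-- Energy `E_C(T) = Z_C(T)⁻¹ Σ_{p ∈ Dom C} |p| 2^(-|p|/T)`. -/
noncomputable def Efun (C : Computer) (T : ℝ) : ℝ :=
  (Zfun C T)⁻¹ * ∑' p : C.f.Dom, (p.1.length : ℝ) * boltzmann T p.1

/-- Statistical mechanical entropy `S_C(T) = (E_C(T) - F_C(T))/T`. -/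
noncomputable def Sfun (C : Computer) (T : ℝ) : ℝ :=
  (Efun C T - Ffun C T) / T

/-- `𝒵(V)`: the set of `T ∈ (0,1)` with `Z_V(T)` computable. -/
def setZ (V : Computer) : Set ℝ := {T | T ∈ Set.Ioo 0 1 ∧ ComputableReal (Zfun V T)}

/-- `ℱ(V)`: the set of `T ∈ (0,1)` with `F_V(T)` computable. -/
def setF (V : Computer) : Set ℝ := {T | T ∈ Set.Ioo 0 1 ∧ ComputableReal (Ffun V T)}

/-- `ℰ(V)`: the set of `T ∈ (0,1)` with `E_V(T)` computable. -/
def setE (V : Computer) : Set ℝ := {T | T ∈ Set.Ioo 0 1 ∧ ComputableReal (Efun V T)}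

/-- `𝒮(V)`: the set of `T ∈ (0,1)` with `S_V(T)` computable. -/
def setS (V : Computer) : Set ℝ := {T | T ∈ Set.Ioo 0 1 ∧ ComputableReal (Sfun V T)}

/-- `FP_w` (w.r.t. the optimal computer `U` fixing `H`): the set of `T ∈ (0,1)`
that are weakly Chaitin `T`-random and `T`-compressible. -/
def FPw (U : Computer) : Set ℝ :=
  {T | T ∈ Set.Ioo 0 1 ∧ WeaklyChaitinTRandom U T T ∧ TCompressible U T T}

/-- `FP` (w.r.t. the optimal computer `U` fixing `H`): the set of `T ∈ (0,1)`
that are Chaitin `T`-random and `T`-compressible. -/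
def FP (U : Computer) : Set ℝ :=
  {T | T ∈ Set.Ioo 0 1 ∧ ChaitinTRandom U T T ∧ TCompressible U T T}

/-- A computer is physically reasonable if its domain contains two strings of
different lengths. -/
def PhysicallyReasonable (C : Computer) : Prop :=
  ∃ p ∈ C.f.Dom, ∃ q ∈ C.f.Dom, p.length ≠ q.length

/-- A computable measure machine: `Z_C(1)` is a computable real. -/
def ComputableMeasureMachine (C : Computer) : Prop :=
  ComputableReal (Zfun C 1)

/-- `D` is the composition `C₀ ⊘ C₁ ⊘ ⋯ ⊘ C_{N-1}`: its domain consists of the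
concatenations `p₀p₁⋯p_{N-1}` with each `pᵢ ∈ Dom Cᵢ`, and on such a
concatenation it returns `C₀(p₀)`. -/
def IsComposition {N : ℕ} (C : Fin N → Computer) (hN : 0 < N) (D : Computer) : Prop :=
  (∀ l, l ∈ D.f.Dom ↔
      ∃ ps : Fin N → List Bool, (∀ i, ps i ∈ (C i).f.Dom) ∧ l = (List.ofFn ps).flatten) ∧
  (∀ ps : Fin N → List Bool, (∀ i, ps i ∈ (C i).f.Dom) →
      D.f ((List.ofFn ps).flatten) = (C ⟨0, hN⟩).f (ps ⟨0, hN⟩))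

/-- A sequence of computers is recursive if a single partial recursive function
uniformly computes all of them. -/
def RecursiveSeq (V : ℕ → Computer) : Prop :=
  ∃ F : ℕ × List Bool →. List Bool, Partrec F ∧ ∀ n p, (V n).f p = F (n, p)

theorem primrec_nat_pow : Primrec₂ (fun a b : ℕ => a ^ b) :=
  Primrec₂.unpaired'.1 Nat.Primrec.pow

/-- total search is computable -/
theorem computable_search {α : Type*} [Primcodable α] {p : α → ℕ → Bool} (hp : Computable₂ p)
    (h : ∀ a, ∃ n, p a n = true) :
    ∃ f : α → ℕ, Computable f ∧ (∀ a, p a (f a) = true) ∧ ∀ a, ∀ m < f a, p a m = false := by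
  classical
  refine ⟨fun a => Nat.find (h a), ?_, fun a => Nat.find_spec (h a), fun a m hm => by
    simpa using Nat.find_min (h a) hm⟩
  have h1 : Partrec fun a => Nat.rfind (fun n => (Part.some (p a n))) :=
    Partrec.rfind (p := fun a n => Part.some (p a n)) hp.partrec₂
  refine Partrec.of_eq_tot h1 fun a => ?_
  refine Nat.mem_rfind.2 ⟨by simpa using (Nat.find_spec (h a)).symm, fun hm => ?_⟩
  simpa using (Nat.find_min (h a) hm)

theorem primrec_coprime : PrimrecPred fun p : ℕ × ℕ => Nat.Coprime p.1 p.2 := by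
  classical
  have h0 : PrimrecRel fun (d : ℕ) (p : ℕ) => ¬ (d ∣ p.unpair.1 ∧ d ∣ p.unpair.2) ∨ d = 1 := by
    have hd : ∀ f : ℕ × ℕ → ℕ, Primrec f → PrimrecPred fun q : ℕ × ℕ => q.1 ∣ f q := by
      intro f hf
      refine (Primrec.eq.comp (Primrec.nat_mod.comp hf Primrec.fst) (Primrec.const 0)).of_eq ?_
      intro q
      exact (Nat.dvd_iff_mod_eq_zero ).symm
    exact (((hd _ (Primrec.fst.comp (Primrec.unpair.comp Primrec.snd))).and
      (hd _ (Primrec.snd.comp (Primrec.unpair.comp Primrec.snd)))).not).or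
      (Primrec.eq.comp Primrec.fst (Primrec.const 1))
  have h1 := h0.forall_lt
  have h2 : PrimrecPred fun p : ℕ × ℕ => ∀ x < (p.1 + p.2 + 1), ¬ (x ∣ p.1 ∧ x ∣ p.2) ∨ x = 1 := by
    refine (h1.comp (Primrec.succ.comp (Primrec.nat_add.comp Primrec.fst Primrec.snd))
      (Primrec₂.natPair.comp Primrec.fst Primrec.snd)).of_eq ?_
    intro p
    simp
  refine ((h2.and ((Primrec.eq.comp (Primrec.nat_add.comp Primrec.fst Primrec.snd)
    (Primrec.const 0)).not))).of_eq ?_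
  rintro ⟨a, b⟩
  simp only
  constructor
  · rintro ⟨h, h'⟩
    rcases h (Nat.gcd a b) (by
      rcases Nat.eq_zero_or_pos a with h0 | h0
      · subst h0; simp
      · have := Nat.gcd_le_left b h0; omega) with h | h
    · exact absurd ⟨Nat.gcd_dvd_left _ _, Nat.gcd_dvd_right _ _⟩ h
    · exact h
  · intro h
    refine ⟨fun x _ => ?_, ?_⟩
    · by_cases hx : x ∣ a ∧ x ∣ b
      · right
        have := Nat.dvd_gcd hx.1 hx.2
        rw [h] at this
        exact Nat.dvd_one.1 this
      · left; exact hx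
    · intro h0
      have ha : a = 0 := by omega
      have hb : b = 0 := by omega
      subst ha; subst hb
      simp at h

theorem computable_subtype_ofNat (s : Set ℕ) [DecidablePred (· ∈ s)] [Infinite s]
    (hs : Computable fun n => decide (n ∈ s)) :
    Computable fun n => (Nat.Subtype.ofNat s n : ℕ) := by
  classical
  have hinf : ∀ x : ℕ, ∃ m, decide (x + m ∈ s) = true := by
    intro x
    obtain ⟨y, hy, hxy⟩ := (Set.infinite_coe_iff.1 (inferInstance : Infinite s)).exists_gt x
    exact ⟨y - x, by simpa [Nat.add_sub_cancel' hxy.le] using hy⟩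
  obtain ⟨g, hg, hg1, hg2⟩ := computable_search (p := fun x m => decide (x + m ∈ s))
    (hs.comp (Primrec.nat_add.to_comp)) hinf
  have key : Computable fun n : ℕ => (Nat.rec (g 0) (fun _ y => y + 1 + g (y + 1)) n : ℕ) := by
    refine Computable.nat_rec (f := fun n : ℕ => n) (g := fun _ => g 0)
      (h := fun _ p => p.2 + 1 + g (p.2 + 1)) Computable.id (Computable.const _) ?_
    have h1 : Computable fun q : ℕ × ℕ × ℕ => q.2.2 + 1 := Computable.succ.comp (Computable.snd.comp Computable.snd)
    exact (Primrec.nat_add.to_comp).comp h1 (hg.comp h1)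
  refine key.of_eq fun n => ?_
  induction n with
  | zero =>
    simp only [Nat.Subtype.ofNat]
    have h1 := hg1 0
    simp at h1
    apply le_antisymm
    · by_contra hlt
      push Not at hlt
      have := hg2 0 _ hlt
      simp at this
    · exact (bot_le : (⊥ : s) ≤ ⟨g 0, h1⟩)
  | succ n ih =>
    simp only [Nat.Subtype.ofNat, Nat.Subtype.succ]
    rw [ih]
    set x := (Nat.Subtype.ofNat s n : ℕ)
    have h1 := hg1 (x + 1)
    simp at h1
    have : g (x + 1) = Nat.find (Nat.Subtype.exists_succ (Nat.Subtype.ofNat s n)) := by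
      symm
      rw [Nat.find_eq_iff]
      refine ⟨by simpa [add_right_comm] using h1, fun m hm => ?_⟩
      have := hg2 _ _ hm
      simpa [add_right_comm] using this
    rw [this]; omega

theorem computable_rat : Computable (fun q : ℚ => q.num.toNat) ∧ Computable (fun q : ℚ => q.den) := by
  classical
  let E : ℚ → ℕ := fun q => Nat.pair (Equiv.intEquivNat q.num) q.den
  let _ := @Encodable.decidableRangeEncode ℚ _
  have hEE : ∀ q : ℚ, @Encodable.encode ℚ Rat.instEncodable q = E q := fun q => rfl
  let _ : Infinite (Set.range (@Encodable.encode ℚ Rat.instEncodable)) :=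
    Infinite.of_injective _ (Equiv.ofInjective _ Encodable.encode_injective).injective
  have hIntEq : ∀ i : ℤ, (i.natAbs = (Equiv.intEquivNat i + 1) / 2) ∧ 
      i.toNat = if Equiv.intEquivNat i % 2 = 0 then Equiv.intEquivNat i / 2 else 0 := by
    intro i
    rcases i with i | i
    · have : Equiv.intEquivNat (Int.ofNat i) = 2 * i := rfl
      rw [this]; simp; omega
    · have : Equiv.intEquivNat (Int.negSucc i) = 2 * i + 1 := rfl
      rw [this]; simp; omega
  have hset : Computable fun n => decide (n ∈ Set.range (@Encodable.encode ℚ Rat.instEncodable)) := by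
    have hp : PrimrecPred fun n : ℕ => Nat.Coprime ((n.unpair.1 + 1) / 2) n.unpair.2 ∧ ¬ n.unpair.2 = 0 := by
      have h1 : Primrec fun n : ℕ => (n.unpair.1 + 1) / 2 :=
        Primrec.nat_div.comp (Primrec.succ.comp (Primrec.fst.comp Primrec.unpair)) (Primrec.const 2)
      have h2 : Primrec fun n : ℕ => n.unpair.2 := Primrec.snd.comp Primrec.unpair
      exact (primrec_coprime.comp (h1.pair h2)).and (Primrec.eq.comp h2 (Primrec.const 0)).not
    obtain ⟨_, hp⟩ := hp
    refine hp.to_comp.of_eq fun n => ?_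
    simp only [decide_eq_decide]
    constructor
    · rintro ⟨h1, h2⟩
      obtain ⟨i, hi⟩ := Equiv.intEquivNat.surjective n.unpair.1
      rw [← hi, ← (hIntEq i).1] at h1
      refine ⟨⟨i, n.unpair.2, h2, h1⟩, ?_⟩
      rw [hEE]
      simp only [E, hi, Nat.pair_unpair]
    · rintro ⟨q, rfl⟩
      rw [hEE]
      simp only [E, Nat.unpair_pair]
      rw [← (hIntEq _).1]
      exact ⟨q.reduced, q.den_nz⟩
  have h1 := computable_subtype_ofNat _ hset
  have h2 : Computable E := by
    refine (h1.comp (Computable.encode (α := ℚ))).of_eq fun q => ?_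
    rw [← hEE]
    have h3 : Denumerable.ofNat ℚ (@Encodable.encode ℚ Rat.instDenumerable.toEncodable q) = q :=
      Denumerable.ofNat_encode q
    have h4 : ∀ n, Denumerable.ofNat ℚ n = (Encodable.equivRangeEncode ℚ).symm (Nat.Subtype.ofNat _ n) :=
      fun n => rfl
    rw [h4, Equiv.symm_apply_eq] at h3
    have h5 := congrArg Subtype.val h3
    exact h5
  have hu : Computable fun q => (E q).unpair := Computable.unpair.comp h2
  constructor
  · have hp : Primrec fun n : ℕ => if n % 2 = 0 then n / 2 else 0 :=
      Primrec.ite (Primrec.eq.comp (Primrec.nat_mod.comp Primrec.id (Primrec.const 2)) (Primrec.const 0))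
        (Primrec.nat_div.comp Primrec.id (Primrec.const 2)) (Primrec.const 0)
    refine (hp.to_comp.comp (Computable.fst.comp hu)).of_eq fun q => ?_
    simp only [E, Nat.unpair_pair]
    exact (hIntEq _).2.symm
  · refine (Computable.snd.comp hu).of_eq fun q => ?_
    simp [E]


theorem approx_T {T : ℝ} (hT : 0 < T) (h : ComputableReal T) :
    ∃ u u' v : ℕ → ℕ, Computable u ∧ Computable u' ∧ Computable v ∧
      (∀ n, 0 < u n ∧ 0 < u' n ∧ 0 < v n ∧ (u n : ℝ) / v n < T ∧ T < (u' n : ℝ) / v n) ∧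
      Tendsto (fun n => (u n : ℝ) / v n) atTop (𝓝 T) ∧
      Tendsto (fun n => (u' n : ℝ) / v n) atTop (𝓝 T) := by
  obtain ⟨f, hf, hfT⟩ := h
  obtain ⟨n0, hn0⟩ := exists_nat_gt (2 / T)
  let N : ℕ → ℕ := fun n => n + n0 + 1
  have hN : Computable N := Computable.succ.comp
    ((Primrec.nat_add.comp Primrec.id (Primrec.const n0)).to_comp)
  let p : ℕ → ℕ := fun n => (f (N n)).num.toNat
  let q : ℕ → ℕ := fun n => (f (N n)).den
  have hp : Computable p := computable_rat.1.comp (hf.comp hN)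
  have hq : Computable q := computable_rat.2.comp (hf.comp hN)
  have hmul : Computable fun n => p n * N n := (Primrec.nat_mul.to_comp).comp hp hN
  have hNpos : ∀ n, (0 : ℝ) < N n := fun n => by simp only [N]; positivity
  have hqpos : ∀ n, (0 : ℝ) < q n := fun n => by
    have := (f (N n)).den_pos
    exact_mod_cast this
  have hNT : ∀ n, 2 / (N n : ℝ) < T := by
    intro n
    rw [div_lt_iff₀ (hNpos n)]
    rw [div_lt_iff₀ hT] at hn0
    have : (n0 : ℝ) ≤ N n := by simp only [N]; push_cast; linarith [Nat.cast_nonneg (α := ℝ) n]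
    nlinarith
  have happ : ∀ n, |T - (f (N n) : ℝ)| < 1 / (N n : ℝ) := fun n => hfT (N n) (by simp [N])
  have hfpos : ∀ n, 1 / (N n : ℝ) < f (N n) := by
    intro n
    have h1 := abs_lt.1 (happ n)
    have h2 := hNT n
    have : 2 / (N n : ℝ) = 1 / N n + 1 / N n := by ring
    linarith [h1.2]
  have hfeq : ∀ n, (f (N n) : ℝ) = (p n : ℝ) / q n := by
    intro n
    have h0 : (0 : ℝ) < f (N n) := lt_trans (by have := hNpos n; positivity) (hfpos n)
    have h0' : 0 < f (N n) := by exact_mod_cast h0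
    have hnum : 0 ≤ (f (N n)).num := (Rat.num_pos.2 h0').le
    have h3 : ((p n : ℤ)) = (f (N n)).num := Int.toNat_of_nonneg hnum
    have h4 : (p n : ℝ) = ((f (N n)).num : ℝ) := by exact_mod_cast congrArg (Int.cast (R := ℝ)) h3
    rw [h4]
    exact Rat.cast_def _
  have hlt : ∀ n, q n < p n * N n := by
    intro n
    have h1 := hfpos n
    rw [hfeq, div_lt_div_iff₀ (hNpos n) (hqpos n)] at h1
    have : (q n : ℝ) < p n * N n := by linarith
    exact_mod_cast this
  have hlo : ∀ n, ((p n * N n - q n : ℕ) : ℝ) / ((q n * N n : ℕ) : ℝ) = f (N n) - 1 / N n := by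
    intro n
    rw [Nat.cast_sub (hlt n).le, hfeq]
    push_cast
    have := hNpos n; have := hqpos n
    field_simp
  have hhi : ∀ n, ((p n * N n + q n : ℕ) : ℝ) / ((q n * N n : ℕ) : ℝ) = f (N n) + 1 / N n := by
    intro n
    rw [hfeq]
    push_cast
    have := hNpos n; have := hqpos n
    field_simp
  have hNlim : Tendsto (fun n => 1 / (N n : ℝ)) atTop (𝓝 0) := by
    have h1 : Tendsto N atTop atTop := tendsto_atTop_mono (fun n => by simp only [N, id]; omega) tendsto_id
    exact tendsto_one_div_atTop_nhds_zero_nat.comp h1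
  have hflim : Tendsto (fun n => (f (N n) : ℝ)) atTop (𝓝 T) := by
    rw [tendsto_iff_dist_tendsto_zero]
    refine squeeze_zero (fun _ => dist_nonneg) (fun n => ?_) hNlim
    rw [Real.dist_eq, abs_sub_comm]
    exact (happ n).le
  refine ⟨fun n => p n * N n - q n, fun n => p n * N n + q n, fun n => q n * N n,
    (Primrec.nat_sub.to_comp).comp hmul hq, (Primrec.nat_add.to_comp).comp hmul hq,
    (Primrec.nat_mul.to_comp).comp hq hN, fun n => ⟨Nat.sub_pos_of_lt (hlt n), ?_, ?_, ?_, ?_⟩, ?_, ?_⟩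
  · exact lt_of_lt_of_le (lt_of_le_of_lt (Nat.zero_le _) (hlt n)) (Nat.le_add_right _ _)
  · have h1 : 0 < q n := by exact_mod_cast hqpos n
    exact Nat.mul_pos h1 (by simp [N])
  · rw [hlo]
    have := abs_lt.1 (happ n); linarith [this.1]
  · rw [hhi]
    have := abs_lt.1 (happ n); linarith [this.2]
  · simp only [hlo]
    simpa using hflim.sub hNlim
  · simp only [hhi]
    simpa using hflim.add hNlim

/-- a sequence of reals that is uniformly computable -/
def UComp (w : ℕ → ℝ) : Prop :=
  ∃ f : ℕ → ℕ → ℕ, Computable₂ f ∧ ∀ l K, |(f l K : ℝ) - 2 ^ K * w l| ≤ 2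

theorem cert_low {a l K u v : ℕ} {T : ℝ} (hu : 0 < u) (hv : 0 < v) (hT : (u : ℝ) / v < T)
    (h : a ^ u * 2 ^ (l * v) ≤ 2 ^ (K * u)) : (a : ℝ) ≤ 2 ^ K * (2 : ℝ) ^ (-(l : ℝ) / T) := by
  have hu' : (0 : ℝ) < u := by exact_mod_cast hu
  have hv' : (0 : ℝ) < v := by exact_mod_cast hv
  have hT0 : 0 < T := lt_trans (by positivity) hT
  have h1 : ((a : ℝ)) ^ u * 2 ^ (l * v) ≤ 2 ^ (K * u) := by exact_mod_cast h
  have h2 : (a : ℝ) ^ u ≤ (2 ^ K * (2 : ℝ) ^ (-(l : ℝ) / T)) ^ u := by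
    have h3 : (2 ^ K * (2 : ℝ) ^ (-(l : ℝ) / T)) ^ u = 2 ^ (K * u) * (2 : ℝ) ^ (-(l : ℝ) / T * u) := by
      rw [mul_pow, ← pow_mul, Real.rpow_mul_natCast (by norm_num)]
    rw [h3]
    have h4 : (2 : ℝ) ^ (-((l * v : ℕ) : ℝ)) ≤ (2 : ℝ) ^ (-(l : ℝ) / T * u) := by
      apply Real.rpow_le_rpow_of_exponent_le (by norm_num)
      rw [div_lt_iff₀ hv'] at hT
      push_cast
      rw [neg_div, neg_mul, neg_le_neg_iff, div_mul_eq_mul_div, div_le_iff₀ hT0, mul_assoc]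
      gcongr
      linarith
    calc (a : ℝ) ^ u = ((a : ℝ) ^ u * 2 ^ (l * v)) * (2 : ℝ) ^ (-((l * v : ℕ) : ℝ)) := by
          rw [Real.rpow_neg (by norm_num), Real.rpow_natCast, mul_assoc, mul_inv_cancel₀ (by positivity), mul_one]
      _ ≤ _ := by gcongr
  exact le_of_pow_le_pow_left₀ hu.ne' (by positivity) h2

theorem cert_high {a l K u v : ℕ} {T : ℝ} (hu : 0 < u) (hv : 0 < v) (hT0 : 0 < T) (hT : T < (u : ℝ) / v)
    (h : 2 ^ (K * u) ≤ a ^ u * 2 ^ (l * v)) : 2 ^ K * (2 : ℝ) ^ (-(l : ℝ) / T) ≤ (a : ℝ) := by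
  have hu' : (0 : ℝ) < u := by exact_mod_cast hu
  have hv' : (0 : ℝ) < v := by exact_mod_cast hv
  have h1 : 2 ^ (K * u) ≤ ((a : ℝ)) ^ u * 2 ^ (l * v) := by exact_mod_cast h
  have h2 : (2 ^ K * (2 : ℝ) ^ (-(l : ℝ) / T)) ^ u ≤ (a : ℝ) ^ u := by
    have h3 : (2 ^ K * (2 : ℝ) ^ (-(l : ℝ) / T)) ^ u = 2 ^ (K * u) * (2 : ℝ) ^ (-(l : ℝ) / T * u) := by
      rw [mul_pow, ← pow_mul, Real.rpow_mul_natCast (by norm_num)]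
    rw [h3]
    have h4 : (2 : ℝ) ^ (-(l : ℝ) / T * u) ≤ (2 : ℝ) ^ (-((l * v : ℕ) : ℝ)) := by
      apply Real.rpow_le_rpow_of_exponent_le (by norm_num)
      rw [lt_div_iff₀ hv'] at hT
      push_cast
      rw [neg_div, neg_mul, neg_le_neg_iff, div_mul_eq_mul_div, le_div_iff₀ hT0, mul_assoc]
      gcongr
      linarith
    calc 2 ^ (K * u) * (2 : ℝ) ^ (-(l : ℝ) / T * u)
        ≤ ((a : ℝ) ^ u * 2 ^ (l * v)) * (2 : ℝ) ^ (-((l * v : ℕ) : ℝ)) := by gcongr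
      _ = (a : ℝ) ^ u := by
          rw [Real.rpow_neg (by norm_num), Real.rpow_natCast, mul_assoc, mul_inv_cancel₀ (by positivity), mul_one]
  exact le_of_pow_le_pow_left₀ hu.ne' (by positivity) h2

theorem cert_low_ex {a l K u v : ℕ} (hu : 0 < u) 
    (h : (a : ℝ) ≤ 2 ^ K * (2 : ℝ) ^ (-(l : ℝ) / ((u : ℝ) / v))) :
    a ^ u * 2 ^ (l * v) ≤ 2 ^ (K * u) := by
  have hu' : (0 : ℝ) < u := by exact_mod_cast hu
  have h2 : (a : ℝ) ^ u ≤ (2 ^ K * (2 : ℝ) ^ (-(l : ℝ) / ((u : ℝ) / v))) ^ u := by gcongr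
  rw [mul_pow, ← pow_mul, ← Real.rpow_mul_natCast (by norm_num)] at h2
  have h3 : -(l : ℝ) / ((u : ℝ) / v) * u = -((l * v : ℕ) : ℝ) := by
    push_cast; field_simp
  rw [h3, Real.rpow_neg (by norm_num), Real.rpow_natCast, ← div_eq_mul_inv, le_div_iff₀ (by positivity)] at h2
  exact_mod_cast h2

theorem cert_high_ex {a l K u v : ℕ} (hu : 0 < u)
    (h : 2 ^ K * (2 : ℝ) ^ (-(l : ℝ) / ((u : ℝ) / v)) ≤ (a : ℝ)) :
    2 ^ (K * u) ≤ a ^ u * 2 ^ (l * v) := by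
  have hu' : (0 : ℝ) < u := by exact_mod_cast hu
  have h2 : (2 ^ K * (2 : ℝ) ^ (-(l : ℝ) / ((u : ℝ) / v))) ^ u ≤ (a : ℝ) ^ u := by gcongr
  rw [mul_pow, ← pow_mul, ← Real.rpow_mul_natCast (by norm_num)] at h2
  have h3 : -(l : ℝ) / ((u : ℝ) / v) * u = -((l * v : ℕ) : ℝ) := by
    push_cast; field_simp
  rw [h3, Real.rpow_neg (by norm_num), Real.rpow_natCast, ← div_eq_mul_inv, div_le_iff₀ (by positivity)] at h2
  exact_mod_cast h2

theorem ucomp_b {T : ℝ} (hT : 0 < T) (h : ComputableReal T) :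
    UComp (fun l => (2 : ℝ) ^ (-(l : ℝ) / T)) := by
  obtain ⟨u, u', v, cu, cu', cv, hb, hl, hl'⟩ := approx_T hT h
  -- search over y = pair a i
  let P : ℕ × ℕ → ℕ → Bool := fun x y =>
    decide ((y.unpair.1 - 1) ^ u y.unpair.2 * 2 ^ (x.1 * v y.unpair.2) ≤ 2 ^ (x.2 * u y.unpair.2)) &&
    decide (2 ^ (x.2 * u' y.unpair.2) ≤ (y.unpair.1 + 1) ^ u' y.unpair.2 * 2 ^ (x.1 * v y.unpair.2))
  have hP : Computable₂ P := by
    have hle : Computable₂ (fun a b : ℕ => decide (a ≤ b)) := by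
      obtain ⟨_, h⟩ := Primrec.nat_le
      refine h.to_comp.of_eq fun n => ?_
      simp only [decide_eq_decide]
    have hmul : Computable₂ (fun a b : ℕ => a * b) := Primrec.nat_mul.to_comp
    have hpow : Computable₂ (fun a b : ℕ => a ^ b) := primrec_nat_pow.to_comp
    have ha : Computable fun q : (ℕ × ℕ) × ℕ => q.2.unpair.1 := Computable.fst.comp (Computable.unpair.comp Computable.snd)
    have hi : Computable fun q : (ℕ × ℕ) × ℕ => q.2.unpair.2 := Computable.snd.comp (Computable.unpair.comp Computable.snd)
    have hx : Computable fun q : (ℕ × ℕ) × ℕ => q.1.1 := Computable.fst.comp Computable.fst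
    have hK : Computable fun q : (ℕ × ℕ) × ℕ => q.1.2 := Computable.snd.comp Computable.fst
    have h2 : Computable fun q : (ℕ × ℕ) × ℕ => 2 := Computable.const 2
    have k1 := hle.comp (hmul.comp (hpow.comp (Computable.pred.comp ha) (cu.comp hi))
        (hpow.comp h2 (hmul.comp hx (cv.comp hi)))) (hpow.comp h2 (hmul.comp hK (cu.comp hi)))
    have k2 := hle.comp (hpow.comp h2 (hmul.comp hK (cu'.comp hi)))
      (hmul.comp (hpow.comp (Computable.succ.comp ha) (cu'.comp hi))
        (hpow.comp h2 (hmul.comp hx (cv.comp hi))))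
    exact (Primrec.and.to_comp).comp k1 k2
  have hex : ∀ x, ∃ y, P x y = true := by
    rintro ⟨l, K⟩
    set X : ℝ := 2 ^ K * (2 : ℝ) ^ (-(l : ℝ) / T) with hX
    have hX0 : 0 < X := by positivity
    have hcont : ContinuousAt (fun t : ℝ => 2 ^ K * (2 : ℝ) ^ (-(l : ℝ) / t)) T := by
      have : ContinuousAt (fun t : ℝ => -(l : ℝ) / t) T := continuousAt_const.div continuousAt_id hT.ne'
      exact continuousAt_const.mul (continuousAt_const.rpow this (Or.inl (by norm_num)))
    set a := ⌊X⌋₊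
    have h1 : ((a - 1 : ℕ) : ℝ) < X := by
      rcases Nat.eq_zero_or_pos a with h0 | h0
      · rw [h0]; simpa using hX0
      · have : a - 1 < a := by omega
        have h5 : ((a - 1 : ℕ) : ℝ) < a := by exact_mod_cast this
        exact h5.trans_le (Nat.floor_le hX0.le)
    have h2 : X < ((a + 1 : ℕ) : ℝ) := by push_cast; exact Nat.lt_floor_add_one X
    have e1 := (hcont.tendsto.comp hl).eventually (lt_mem_nhds h1)
    have e2 := (hcont.tendsto.comp hl').eventually (gt_mem_nhds h2)
    obtain ⟨i, hi1, hi2⟩ := (e1.and e2).exists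
    refine ⟨Nat.pair a i, ?_⟩
    simp only [P, Nat.unpair_pair, Bool.and_eq_true, decide_eq_true_eq]
    exact ⟨cert_low_ex (hb i).1 hi1.le, cert_high_ex (hb i).2.1 hi2.le⟩
  obtain ⟨g, hg, hg1, -⟩ := computable_search hP hex
  refine ⟨fun l K => (g (l, K)).unpair.1, Computable.fst.comp (Computable.unpair.comp hg), fun l K => ?_⟩
  have := hg1 (l, K)
  simp only [P, Bool.and_eq_true, decide_eq_true_eq] at this
  set i := (g (l, K)).unpair.2
  set a := (g (l, K)).unpair.1
  have h1 := cert_low (hb i).1 (hb i).2.2.1 (hb i).2.2.2.1 this.1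
  have h2 := cert_high (hb i).2.1 (hb i).2.2.1 hT (hb i).2.2.2.2 this.2
  have h3 : (a : ℝ) ≤ ((a - 1 : ℕ) : ℝ) + 1 := by
    have : a ≤ (a - 1) + 1 := by omega
    exact_mod_cast this
  push_cast at h2
  rw [abs_le]
  constructor <;> linarith


theorem computable_le : Computable₂ (fun a b : ℕ => decide (a ≤ b)) := by
  obtain ⟨_, h⟩ := Primrec.nat_le
  refine h.to_comp.of_eq fun n => ?_
  simp only [decide_eq_decide]

theorem computable_add : Computable₂ (fun a b : ℕ => a + b) := Primrec.nat_add.to_comp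
theorem computable_sub : Computable₂ (fun a b : ℕ => a - b) := Primrec.nat_sub.to_comp
theorem computable_mul : Computable₂ (fun a b : ℕ => a * b) := Primrec.nat_mul.to_comp
theorem computable_div : Computable₂ (fun a b : ℕ => a / b) := Primrec.nat_div.to_comp
theorem computable_mod : Computable₂ (fun a b : ℕ => a % b) := Primrec.nat_mod.to_comp
theorem computable_pow : Computable₂ (fun a b : ℕ => a ^ b) := primrec_nat_pow.to_comp

theorem computable_sum {α : Type*} [Primcodable α] {N : α → ℕ} {g : α → ℕ → ℕ}
    (hN : Computable N) (hg : Computable₂ g) :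
    Computable fun a => ∑ e ∈ Finset.range (N a), g a e := by
  have key : Computable fun a => (Nat.rec 0 (fun e y => y + g a e) (N a) : ℕ) := by
    refine Computable.nat_rec (f := N) (g := fun _ => 0)
      (h := fun a p => p.2 + g a p.1) hN (Computable.const 0) ?_
    have h1 : Computable fun q : α × ℕ × ℕ => q.2.2 := Computable.snd.comp Computable.snd
    have h2 : Computable fun q : α × ℕ × ℕ => q.2.1 := Computable.fst.comp Computable.snd
    exact computable_add.comp h1 (hg.comp Computable.fst h2)
  refine key.of_eq fun a => ?_
  induction N a with
  | zero => simp
  | succ n ih => rw [Finset.sum_range_succ, ← ih]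

theorem nat_div_pow_approx (a : ℕ) (k : ℕ) : |((a / 2 ^ k : ℕ) : ℝ) - (a : ℝ) / 2 ^ k| ≤ 1 := by
  have h1 : ((a / 2 ^ k : ℕ) : ℝ) ≤ (a : ℝ) / ((2 ^ k : ℕ) : ℝ) := Nat.cast_div_le
  have h2 : a < (a / 2 ^ k + 1) * 2 ^ k := by
    have := Nat.lt_div_mul_add (a := a) (b := 2 ^ k) (by positivity)
    linarith
  have h3 : (a : ℝ) < (((a / 2 ^ k : ℕ) : ℝ) + 1) * 2 ^ k := by exact_mod_cast h2
  rw [← div_lt_iff₀ (by positivity)] at h3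
  push_cast at h1
  rw [abs_le]
  constructor <;> linarith

theorem ucomp_mul_len {w : ℕ → ℝ} (h : UComp w) : UComp (fun l => (l : ℝ) * w l) := by
  obtain ⟨f, hf, hfw⟩ := h
  refine ⟨fun l K => l * f l (K + l) / 2 ^ l, ?_, fun l K => ?_⟩
  · have h1 : Computable₂ fun l K : ℕ => l := Computable.fst
    have h2 : Computable₂ fun l K : ℕ => K := Computable.snd
    have h3 : Computable₂ fun l K : ℕ => f l (K + l) :=
      Computable₂.comp (hf) Computable.fst (computable_add.comp Computable.snd Computable.fst)
    exact computable_div.comp (computable_mul.comp Computable.fst h3)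
      (computable_pow.comp (Computable.const 2) Computable.fst)
  · have h1 := nat_div_pow_approx (l * f l (K + l)) l
    have h2 := hfw l (K + l)
    have h3 : |((l * f l (K + l) : ℕ) : ℝ) / 2 ^ l - 2 ^ K * (l * w l)| ≤ 1 := by
      have : ((l * f l (K + l) : ℕ) : ℝ) / 2 ^ l - 2 ^ K * (l * w l) =
          (l / 2 ^ l) * ((f l (K + l) : ℝ) - 2 ^ (K + l) * w l) := by
        push_cast; rw [pow_add]; field_simp
      rw [this, abs_mul, abs_of_nonneg (by positivity)]
      have h4 : (l : ℝ) / 2 ^ l ≤ 1 / 2 := by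
        rw [div_le_div_iff₀ (by positivity) (by norm_num)]
        have : l * 2 ≤ 1 * 2 ^ l := by
          rcases l with _ | l
          · simp
          · have := Nat.lt_two_pow_self (n := l)
            rw [pow_succ]; omega
        exact_mod_cast this
      calc _ ≤ (1 / 2 : ℝ) * 2 := by gcongr
        _ = 1 := by norm_num
    calc _ ≤ _ := abs_sub_le _ (((l * f l (K + l) : ℕ) : ℝ) / 2 ^ l) _
      _ ≤ 2 := by linarith

theorem ucomp_half : UComp (fun l => (1 / 2 : ℝ) ^ l) := by
  refine ⟨fun l K => 2 ^ K / 2 ^ l, ?_, fun l K => ?_⟩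
  · exact computable_div.comp (computable_pow.comp (Computable.const 2) Computable.snd)
      (computable_pow.comp (Computable.const 2) Computable.fst)
  · have := nat_div_pow_approx (2 ^ K) l
    push_cast at this ⊢
    rw [one_div, inv_pow, ← div_eq_mul_inv]
    linarith

/-- stage sums -/
def stage (halt : ℕ → ℕ → Bool) (len : ℕ → ℕ) (w : ℕ → ℝ) (m : ℕ) : ℝ :=
  ∑ e ∈ Finset.range m, if halt m e then w (len e) else 0

theorem ucomp_stage {halt : ℕ → ℕ → Bool} {len : ℕ → ℕ} {w : ℕ → ℝ} (hh : Computable₂ halt)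
    (hl : Computable len) (h : UComp w) : UComp (stage halt len w) := by
  obtain ⟨f, hf, hfw⟩ := h
  refine ⟨fun m K => (∑ e ∈ Finset.range m, bif halt m e then f (len e) (K + (m + 1)) else 0) / 2 ^ (m + 1),
    ?_, fun m K => ?_⟩
  · have hs : Computable fun p : ℕ × ℕ => p.1 + 1 := Computable.succ.comp Computable.fst
    refine computable_div.comp ?_ (computable_pow.comp (Computable.const 2) hs)
    refine computable_sum (N := fun p : ℕ × ℕ => p.1)
      (g := fun p e => bif halt p.1 e then f (len e) (p.2 + (p.1 + 1)) else 0) Computable.fst ?_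
    have e1 : Computable fun q : (ℕ × ℕ) × ℕ => q.2 := Computable.snd
    have e2 : Computable fun q : (ℕ × ℕ) × ℕ => q.1.1 := Computable.fst.comp Computable.fst
    have e3 : Computable fun q : (ℕ × ℕ) × ℕ => q.1.2 := Computable.snd.comp Computable.fst
    exact Computable.cond (hh.comp e2 e1)
      (hf.comp (hl.comp e1) (computable_add.comp e3 (Computable.succ.comp e2))) (Computable.const 0)
  · set s := ∑ e ∈ Finset.range m, bif halt m e then f (len e) (K + (m + 1)) else 0 with hs
    have h1 := nat_div_pow_approx s (m + 1)
    have h2 : |(s : ℝ) - 2 ^ (K + (m + 1)) * stage halt len w m| ≤ m * 2 := by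
      rw [hs, stage, Finset.mul_sum]
      push_cast
      rw [← Finset.sum_sub_distrib]
      refine (Finset.abs_sum_le_sum_abs _ _).trans ?_
      calc _ ≤ ∑ e ∈ Finset.range m, (2 : ℝ) := by
            refine Finset.sum_le_sum fun e _ => ?_
            cases halt m e
            · simp
            · simpa using hfw (len e) (K + (m + 1))
        _ = m * 2 := by simp
    have h3 : |(s : ℝ) / 2 ^ (m + 1) - 2 ^ K * stage halt len w m| ≤ 1 := by
      have : (s : ℝ) / 2 ^ (m + 1) - 2 ^ K * stage halt len w m =
        (1 / 2 ^ (m + 1)) * ((s : ℝ) - 2 ^ (K + (m + 1)) * stage halt len w m) := by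
        rw [pow_add (2 : ℝ) K]; field_simp
      rw [this, abs_mul, abs_of_nonneg (by positivity)]
      have h4 : (m : ℝ) * 2 ≤ 2 ^ (m + 1) := by
        have : m * 2 ≤ 2 ^ (m + 1) := by
          have := Nat.lt_two_pow_self (n := m)
          rw [pow_succ]; omega
        exact_mod_cast this
      calc _ ≤ (1 / 2 ^ (m + 1) : ℝ) * 2 ^ (m + 1) := by gcongr; linarith
        _ = 1 := by field_simp
    calc _ ≤ _ := abs_sub_le _ ((s : ℝ) / 2 ^ (m + 1)) _
      _ ≤ 2 := by linarith


theorem complexity_le {U : Computer} {s p : List Bool} (h : s ∈ U.f p) : complexity U s ≤ p.length :=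
  Nat.sInf_le ⟨p, h, rfl⟩

theorem exists_prog {U : Computer} (hU : Optimal U) (s : List Bool) : ∃ p, s ∈ U.f p := by
  let C : Computer :=
    { f := fun p => ((if p = [] then some s else none : Option (List Bool)) : Part (List Bool))
      partrec := by
        refine Computable.ofOption (f := fun p : List Bool => (if p = [] then some s else none)) ?_
        exact (Primrec.ite (Primrec.eq.comp Primrec.id (Primrec.const [])) (Primrec.const _)
          (Primrec.const _)).to_comp
      dom_nonempty := ⟨[], by simp [PFun.Dom]⟩
      dom_prefixFree := by
        intro p hp q hq _
        have h1 : ∀ p : List Bool, (((if p = [] then some s else none : Option (List Bool)) : Part (List Bool))).Dom → p = [] := by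
          intro p hp
          by_contra h
          simp [h] at hp
        rw [h1 p hp, h1 q hq] }
  obtain ⟨d, hd⟩ := hU C
  obtain ⟨q, hq, -⟩ := hd [] (by simp [C, PFun.Dom])
  refine ⟨q, ?_⟩
  rw [hq]
  simp [C]

theorem exists_prog_min {U : Computer} (hU : Optimal U) (s : List Bool) :
    ∃ p, s ∈ U.f p ∧ p.length = complexity U s := by
  obtain ⟨p, hp⟩ := exists_prog hU s
  exact Nat.sInf_mem (s := {n | ∃ p : List Bool, s ∈ U.f p ∧ p.length = n}) ⟨p.length, p, hp, rfl⟩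

theorem complexity_comp {U V : Computer} (hU : Optimal U) (hV : Optimal V) {g : List Bool →. List Bool}
    (hg : Partrec g) : ∃ d : ℕ, ∀ s y, y ∈ g s → complexity V y ≤ complexity U s + d := by
  by_cases hne : ∃ s y, y ∈ g s
  · let F : List Bool →. List Bool := fun p => (U.f p).bind g
    have hF : Partrec F := U.partrec.bind (hg.comp Computable.snd)
    let C : Computer :=
      { f := F
        partrec := hF
        dom_nonempty := by
          obtain ⟨s, y, h⟩ := hne
          obtain ⟨p, hp⟩ := exists_prog hU s
          exact ⟨p, Part.dom_iff_mem.2 ⟨y, Part.mem_bind hp h⟩⟩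
        dom_prefixFree := by
          intro p hp q hq hpq
          exact U.dom_prefixFree p (Part.Dom.of_bind hp) q (Part.Dom.of_bind hq) hpq }
    obtain ⟨d, hd⟩ := hV C
    refine ⟨d, fun s y hy => ?_⟩
    obtain ⟨p, hp, hpl⟩ := exists_prog_min hU s
    have hyC : y ∈ C.f p := Part.mem_bind hp hy
    obtain ⟨q, hq, hql⟩ := hd p (Part.dom_iff_mem.2 ⟨y, hyC⟩)
    rw [← hq] at hyC
    exact (complexity_le hyC).trans (by omega)
  · push Not at hne
    exact ⟨0, fun s y h => absurd h (hne s y)⟩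

/-- value of a binary string -/
def bval (l : List Bool) : ℕ := l.foldl (fun a b => 2 * a + b.toNat) 0

theorem bval_append (l : List Bool) (b : Bool) : bval (l ++ [b]) = 2 * bval l + b.toNat := by
  simp [bval]

theorem computable_bval : Computable bval := by
  have : Primrec bval := by
    refine Primrec.list_foldl (f := fun l : List Bool => l) (g := fun _ => 0)
      (h := fun _ p => 2 * p.1 + p.2.toNat) Primrec.id (Primrec.const 0) ?_
    have h1 : Primrec fun q : List Bool × ℕ × Bool => 2 * q.2.1 :=
      Primrec.nat_mul.comp (Primrec.const 2) (Primrec.fst.comp Primrec.snd)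
    have h2 : Primrec fun q : List Bool × ℕ × Bool => q.2.2.toNat :=
      (Primrec.dom_finite Bool.toNat).comp (Primrec.snd.comp Primrec.snd)
    exact Primrec.nat_add.comp h1 h2
  exact this.to_comp

theorem bval_surj (L : ℕ) : ∀ x < 2 ^ L, ∃ w : List Bool, w.length = L ∧ bval w = x := by
  induction L with
  | zero => intro x hx; exact ⟨[], rfl, by simp at hx; simp [bval, hx]⟩
  | succ L ih =>
    intro x hx
    obtain ⟨w, hw, hwx⟩ := ih (x / 2) (by rw [pow_succ] at hx; omega)
    refine ⟨w ++ [decide (x % 2 = 1)], by simp [hw], ?_⟩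
    rw [bval_append, hwx]
    rcases Nat.mod_two_eq_zero_or_one x with h | h <;> simp [h] <;> omega

theorem complexity_param {U : Computer} (hU : Optimal U) {g : ℕ × ℕ →. List Bool} (hg : Partrec g)
    {L : ℕ → ℕ} (hL : Computable L) :
    ∃ d : ℕ, ∀ j x, x < 2 ^ L j → ∀ s ∈ g (j, x), complexity U s ≤ j + L j + d := by
  let J : List Bool → ℕ := fun p => p.idxOf false
  have hJ : Computable J := (Primrec.list_idxOf.comp (Primrec.const false) Primrec.id).to_comp
  let o : List Bool → Option (ℕ × ℕ) := fun p =>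
    bif decide (p.length = J p + 1 + L (J p)) then some (J p, bval (p.drop (J p + 1))) else none
  have ho : Computable o := by
    have h1 : Computable fun p => J p + 1 := Computable.succ.comp hJ
    have heq : Computable₂ (fun a b : ℕ => decide (a = b)) := by
      obtain ⟨_, h⟩ := (Primrec.eq (α := ℕ))
      refine h.to_comp.of_eq fun n => ?_
      simp only [decide_eq_decide]
    refine Computable.cond (heq.comp Computable.list_length (computable_add.comp h1 (hL.comp hJ))) ?_
      (Computable.const none)
    exact Computable.option_some.comp (hJ.pair (computable_bval.comp
      (Computable₂.comp (Primrec.list_drop.to_comp) h1 Computable.id)))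
  have hoJ : ∀ p z, z ∈ o p → p.length = J p + 1 + L (J p) := by
    intro p z hz
    by_contra h
    simp [o, h] at hz
  let F : List Bool →. List Bool := fun p => ((o p : Part (ℕ × ℕ))).bind g
  have hF : Partrec F := (Computable.ofOption ho).bind (hg.comp Computable.snd)
  have hFdom : ∀ p, (F p).Dom → p.length = J p + 1 + L (J p) := by
    intro p hp
    obtain ⟨y, hy⟩ := Part.dom_iff_mem.1 hp
    obtain ⟨z, hz, -⟩ := Part.mem_bind_iff.1 hy
    exact hoJ p z (Part.mem_ofOption.1 hz)
  have hmem : ∀ j w, w.length = L j → ∀ s ∈ g (j, bval w), s ∈ F (List.replicate j true ++ false :: w) := by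
    intro j w hw s hs
    have hJ1 : J (List.replicate j true ++ false :: w) = j := by
      simp only [J]
      rw [List.idxOf_append_of_notMem (by simp)]
      simp
    refine Part.mem_bind (a := (j, bval w)) ?_ hs
    rw [Part.mem_ofOption]
    have : o (List.replicate j true ++ false :: w) = some (j, bval w) := by
      simp only [o, hJ1]
      have h2 : (List.replicate j true ++ false :: w).length = j + 1 + L j := by
        simp [hw]; omega
      rw [h2]
      simp [List.drop_append]
    rw [this]; rfl
  by_cases hne : ∃ j x s, x < 2 ^ L j ∧ s ∈ g (j, x)
  · let C : Computer :=
      { f := F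
        partrec := hF
        dom_nonempty := by
          obtain ⟨j, x, s, hx, hs⟩ := hne
          obtain ⟨w, hw, rfl⟩ := bval_surj _ x hx
          exact ⟨_, Part.dom_iff_mem.2 ⟨s, hmem j w hw s hs⟩⟩
        dom_prefixFree := by
          intro p hp q hq hpq
          have h1 := hFdom p hp
          have h2 := hFdom q hq
          have h3 : J q = J p := by
            obtain ⟨t, rfl⟩ := hpq
            simp only [J]
            apply List.idxOf_append_of_mem
            rw [← List.idxOf_lt_length_iff]
            change J p < _
            omega
          rw [h3] at h2
          exact hpq.eq_of_length (by omega) }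
    obtain ⟨d, hd⟩ := hU C
    refine ⟨d + 1, fun j x hx s hs => ?_⟩
    obtain ⟨w, hw, rfl⟩ := bval_surj _ x hx
    have h1 : s ∈ C.f _ := hmem j w hw s hs
    obtain ⟨q, hq, hql⟩ := hd _ (Part.dom_iff_mem.2 ⟨s, h1⟩)
    rw [← hq] at h1
    refine (complexity_le h1).trans (hql.trans ?_)
    simp [hw]; omega
  · push Not at hne
    exact ⟨0, fun j x hx s hs => absurd hs (hne j x s hx)⟩


def plen (e : ℕ) : ℕ := ((Encodable.decode e : Option (List Bool)).getD []).length

theorem computable_plen : Computable plen :=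
  Computable.list_length.comp
    ((Primrec.option_getD.comp Primrec.decode (Primrec.const [])).to_comp)

theorem plen_encode (p : List Bool) : plen (Encodable.encode p) = p.length := by
  simp [plen]

theorem exists_enum (V : Computer) :
    ∃ (halt : ℕ → ℕ → Bool) (B : ℕ → ℕ) (D : ℕ → Finset V.f.Dom),
      Computable₂ halt ∧ Computable B ∧ Monotone D ∧ (∀ p, ∃ m, p ∈ D m) ∧
      (∀ w m, stage halt plen w m = ∑ p ∈ D m, w p.1.length) ∧
      ∀ m p, p ∈ D m → ∀ y ∈ V.f p.1, y.length < B m := by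
  classical
  obtain ⟨c, hc⟩ := Nat.Partrec.Code.exists_code.1 V.partrec
  have hpev : Primrec₂ fun m e => Nat.Partrec.Code.evaln m c e :=
    Nat.Partrec.Code.primrec_evaln.comp ((Primrec.fst.pair (Primrec.const c)).pair Primrec.snd)
  let halt : ℕ → ℕ → Bool := fun m e => (Nat.Partrec.Code.evaln m c e).isSome &&
    decide (Encodable.encode (Encodable.decode e : Option (List Bool)) = e + 1)
  have hhalt : Computable₂ halt := by
    have heq : Primrec₂ (fun a b : ℕ => decide (a = b)) := by
      obtain ⟨_, h⟩ := (Primrec.eq (α := ℕ))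
      refine h.of_eq fun n => ?_
      simp only [decide_eq_decide]
    have h1 : Primrec fun z : ℕ × ℕ => Encodable.encode (Encodable.decode z.2 : Option (List Bool)) :=
      Primrec.encode.comp (Primrec.decode.comp Primrec.snd)
    exact (Primrec.and.comp (Primrec.option_isSome.comp hpev)
      (heq.comp h1 (Primrec.succ.comp Primrec.snd))).to_comp
  have hh1 : ∀ m e, halt m e = true → ∃ x, Nat.Partrec.Code.evaln m c e = some x := by
    intro m e h
    simp only [halt, Bool.and_eq_true] at h
    exact Option.isSome_iff_exists.1 h.1
  have hh2 : ∀ m p x, Nat.Partrec.Code.evaln m c (Encodable.encode (p : List Bool)) = some x →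
      halt m (Encodable.encode p) = true := by
    intro m p x h
    simp [halt, h]
  have hh3 : ∀ m e, halt m e = true →
      Encodable.encode (Encodable.decode e : Option (List Bool)) = e + 1 := by
    intro m e h
    simp only [halt, Bool.and_eq_true, decide_eq_true_eq] at h
    exact h.2
  let B : ℕ → ℕ := fun m => (∑ e ∈ Finset.range m, (Nat.Partrec.Code.evaln m c e).getD 0) + 1
  have hB : Computable B := by
    refine Computable.succ.comp (computable_sum (N := fun m => m)
      (g := fun m e => (Nat.Partrec.Code.evaln m c e).getD 0) Computable.id ?_)
    exact (Primrec.option_getD.comp hpev (Primrec.const 0)).to_comp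
  have hev : ∀ p : List Bool, c.eval (Encodable.encode p) = (V.f p).map Encodable.encode := by
    intro p; rw [hc]; simp
  have hinj : Function.Injective fun p : V.f.Dom => Encodable.encode p.1 := by
    intro p q h
    exact Subtype.ext (Encodable.encode_injective h)
  let D : ℕ → Finset V.f.Dom := fun m =>
    ((Finset.range m).preimage (fun p : V.f.Dom => Encodable.encode p.1) hinj.injOn).filter
      (fun p => halt m (Encodable.encode p.1) = true)
  have hlt : ∀ m e, halt m e = true → e < m := by
    intro m e h
    obtain ⟨x, hx⟩ := hh1 _ _ h
    exact Nat.Partrec.Code.evaln_bound hx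
  have hD : ∀ m p, p ∈ D m ↔ halt m (Encodable.encode p.1) = true := by
    intro m p
    simp only [D, Finset.mem_filter, Finset.mem_preimage, Finset.mem_range]
    exact ⟨fun h => h.2, fun h => ⟨hlt _ _ h, h⟩⟩
  refine ⟨halt, B, D, hhalt, hB, ?_, ?_, ?_, ?_⟩
  · intro m m' hm p hp
    rw [hD] at hp ⊢
    obtain ⟨x, hx⟩ := hh1 _ _ hp
    exact hh2 _ _ x (Nat.Partrec.Code.evaln_mono hm hx)
  · intro p
    have h := p.2
    obtain ⟨y, hy⟩ := Part.dom_iff_mem.1 h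
    have : Encodable.encode y ∈ c.eval (Encodable.encode p.1) := by
      rw [hev]; exact Part.mem_map _ hy
    obtain ⟨m, hm⟩ := Nat.Partrec.Code.evaln_complete.1 this
    exact ⟨m, (hD _ _).2 (hh2 _ _ _ hm)⟩
  · intro w m
    rw [stage, ← Finset.sum_filter]
    symm
    refine Finset.sum_bij (fun p _ => Encodable.encode p.1) ?_ ?_ ?_ ?_
    · intro p hp
      rw [hD] at hp
      simp [hp, hlt _ _ hp]
    · intro p _ q _ h; exact hinj h
    · intro e he
      rw [Finset.mem_filter] at he
      obtain ⟨x, hx⟩ := hh1 _ _ he.2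
      have h1 := Nat.Partrec.Code.evaln_sound hx
      rw [hc] at h1
      obtain ⟨p, hp, hy⟩ := Part.mem_bind_iff.1 h1
      rw [Part.mem_ofOption] at hp
      have hpe : Encodable.encode p = e := by
        have := hh3 _ _ he.2
        rw [Option.mem_def.1 hp, Encodable.encode_some] at this
        exact Nat.succ.inj this
      have hpd : p ∈ V.f.Dom := by
        obtain ⟨z, hz, -⟩ := (Part.mem_map_iff _).1 hy
        exact Part.dom_iff_mem.2 ⟨z, hz⟩
      exact ⟨⟨p, hpd⟩, (hD _ _).2 (by simpa [hpe] using he.2), hpe⟩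
    · intro p _
      rw [plen_encode]
  · intro m p hp y hy
    rw [hD] at hp
    obtain ⟨x, hx⟩ := hh1 _ _ hp
    have h1 := Nat.Partrec.Code.evaln_sound hx
    rw [hev] at h1
    have h2 : x = Encodable.encode y := Part.mem_unique h1 (Part.mem_map _ hy)
    have h3 : y.length ≤ Encodable.encode y := Encodable.length_le_encode y
    have h4 : (Nat.Partrec.Code.evaln m c (Encodable.encode p.1)).getD 0 ≤
        ∑ e ∈ Finset.range m, (Nat.Partrec.Code.evaln m c e).getD 0 :=
      Finset.single_le_sum (f := fun e => (Nat.Partrec.Code.evaln m c e).getD 0)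
        (fun _ _ => Nat.zero_le _) (Finset.mem_range.2 (hlt _ _ hp))
    rw [hx] at h4
    simp only [Option.getD_some] at h4
    simp only [B]
    omega

theorem prefixFree_ud {S : Set (List Bool)} (h : PrefixFree S) (hne : [] ∉ S) :
    InformationTheory.UniquelyDecodable S := by
  intro L₁
  induction L₁ with
  | nil =>
    intro L₂ _ h2 he
    cases L₂ with
    | nil => rfl
    | cons a L =>
      simp at he
      exact absurd (h2 a (by simp)) (by rw [he.1]; exact hne)
  | cons a L₁ ih =>
    intro L₂ h1 h2 he
    cases L₂ with
    | nil =>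
      simp at he
      exact absurd (h1 a (by simp)) (by rw [he.1]; exact hne)
    | cons b L₂ =>
      simp only [List.flatten_cons] at he
      have ha := h1 a (by simp)
      have hb := h2 b (by simp)
      have hab : a = b := by
        rcases List.prefix_or_prefix_of_prefix (l₁ := a) (l₂ := b) (List.prefix_append a L₁.flatten)
          (by rw [he]; exact List.prefix_append b L₂.flatten) with h3 | h3
        · exact h a ha b hb h3
        · exact (h b hb a ha h3).symm
      subst hab
      rw [List.append_cancel_left_eq] at he
      rw [ih L₂ (fun w hw => h1 w (by simp [hw])) (fun w hw => h2 w (by simp [hw])) he]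

theorem kraft (V : Computer) (s : Finset V.f.Dom) :
    ∑ p ∈ s, (1 / 2 : ℝ) ^ p.1.length ≤ 1 := by
  classical
  have key : ∀ S : Finset (List Bool), PrefixFree (S : Set (List Bool)) →
      ∑ p ∈ S, (1 / 2 : ℝ) ^ p.length ≤ 1 := by
    intro S hS
    by_cases hne : [] ∈ S
    · have : S = {[]} := by
        ext p
        constructor
        · intro hp
          have := hS [] hne p hp (List.nil_prefix)
          simp [← this]
        · intro hp
          rw [Finset.mem_singleton] at hp
          rw [hp]; exact hne
      rw [this]; simp
    · have := InformationTheory.kraft_mcmillan_inequality (prefixFree_ud hS (by simpa using hne))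
      simpa using this
  have := key (s.map (Function.Embedding.subtype _)) (by
    intro p hp q hq hpq
    simp only [Finset.coe_map, Set.mem_image] at hp hq
    obtain ⟨p', _, rfl⟩ := hp
    obtain ⟨q', _, rfl⟩ := hq
    exact V.dom_prefixFree _ p'.2 _ q'.2 hpq)
  simpa using this

theorem summable_half (V : Computer) : Summable fun p : V.f.Dom => (1 / 2 : ℝ) ^ p.1.length :=
  summable_of_sum_le (fun _ => by positivity) (kraft V)


theorem len_bound {T t : ℝ} (hT : 0 < T) (hTt : T < t) :
    ∃ C : ℝ, 0 < C ∧ ∀ l : ℕ, (l : ℝ) * (2 : ℝ) ^ (-(l : ℝ) / T) ≤ C * (2 : ℝ) ^ (-(l : ℝ) / t) := by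
  have ht : 0 < t := hT.trans hTt
  set c : ℝ := 1 / T - 1 / t with hc
  have hcpos : 0 < c := sub_pos.2 (one_div_lt_one_div_of_lt hT hTt)
  have hlog : 0 < Real.log 2 := Real.log_pos (by norm_num)
  refine ⟨1 / (c * Real.log 2), by positivity, fun l => ?_⟩
  have h1 : c * Real.log 2 * l ≤ (2 : ℝ) ^ (c * l) := by
    rw [Real.rpow_def_of_pos (by norm_num)]
    have := Real.add_one_le_exp (Real.log 2 * (c * l))
    nlinarith
  have h2 : (2 : ℝ) ^ (-(l : ℝ) / t) = (2 : ℝ) ^ (c * l) * (2 : ℝ) ^ (-(l : ℝ) / T) := by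
    rw [← Real.rpow_add (by norm_num)]
    congr 1
    rw [hc]; field_simp; ring
  rw [h2, ← mul_assoc]
  refine mul_le_mul_of_nonneg_right ?_ (by positivity)
  rw [one_div, inv_mul_eq_div, le_div_iff₀ (by positivity)]
  linarith

theorem half_eq (l : ℕ) : (1 / 2 : ℝ) ^ l = (2 : ℝ) ^ (-(l : ℝ) / 1) := by
  rw [div_one, Real.rpow_neg (by norm_num), Real.rpow_natCast, one_div, inv_pow]

theorem tail_bound {ι : Type*} {f g : ι → ℝ} (hf : Summable f) (hg : Summable g) {c : ℝ} (s : Finset ι)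
    (h : ∀ p ∉ s, f p ≤ c * g p) :
    ∑' p, f p - ∑ p ∈ s, f p ≤ c * (∑' p, g p - ∑ p ∈ s, g p) := by
  have hs : Summable fun p => c * g p - f p := (hg.mul_left c).sub hf
  have := hs.sum_le_tsum s (fun p hp => sub_nonneg.2 (h p hp))
  rw [(hg.mul_left c).tsum_sub hf, tsum_mul_left, Finset.sum_sub_distrib, ← Finset.mul_sum] at this
  linarith

section
variable {V : Computer} {T : ℝ}

theorem summable_b (hT : T ∈ Set.Ioo (0 : ℝ) 1) :
    Summable (fun p : V.f.Dom => boltzmann T p.1) := by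
  refine (summable_half V).of_nonneg_of_le (fun p => by unfold boltzmann; positivity) fun p => ?_
  rw [half_eq, boltzmann]
  refine Real.rpow_le_rpow_of_exponent_le (by norm_num) ?_
  rw [neg_div, neg_div, neg_le_neg_iff]
  exact div_le_div_of_nonneg_left (by positivity) hT.1 hT.2.le

theorem summable_lb (hT : T ∈ Set.Ioo (0 : ℝ) 1) :
    Summable (fun p : V.f.Dom => (p.1.length : ℝ) * boltzmann T p.1) := by
  obtain ⟨C, -, hC⟩ := len_bound hT.1 hT.2
  refine ((summable_half V).mul_left C).of_nonneg_of_le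
    (fun p => by unfold boltzmann; positivity) fun p => ?_
  rw [half_eq, boltzmann]
  exact hC _

theorem finset_tendsto {D : ℕ → Finset V.f.Dom} (hD : Monotone D) (hDe : ∀ p, ∃ m, p ∈ D m) :
    Tendsto D atTop atTop := tendsto_atTop_finset_of_monotone hD hDe

theorem Zfun_pos (hT : T ∈ Set.Ioo (0 : ℝ) 1) : 0 < Zfun V T := by
  obtain ⟨p, hp⟩ := V.dom_nonempty
  exact (summable_b hT).tsum_pos (fun p => by unfold boltzmann; positivity) ⟨p, hp⟩
    (by unfold boltzmann; positivity)

theorem Efun_nonneg : 0 ≤ Efun V T := by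
  refine mul_nonneg (inv_nonneg.2 (tsum_nonneg fun p => ?_)) (tsum_nonneg fun p => ?_)
  · unfold boltzmann; positivity
  · unfold boltzmann; positivity

theorem analysis (hT : T ∈ Set.Ioo (0 : ℝ) 1) {D : ℕ → Finset V.f.Dom} (hD : Monotone D)
    (hDe : ∀ p, ∃ m, p ∈ D m) :
    ∃ (m0 : ℕ) (z0 : ℝ), 0 < z0 ∧
      (∀ m, m0 ≤ m → z0 ≤ ∑ p ∈ D m, boltzmann T p.1 ∧
        0 ≤ Efun V T * ∑ p ∈ D m, boltzmann T p.1 - ∑ p ∈ D m, (p.1.length : ℝ) * boltzmann T p.1 ∧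
        Efun V T * ∑ p ∈ D m, boltzmann T p.1 - ∑ p ∈ D m, (p.1.length : ℝ) * boltzmann T p.1 ≤
          ∑' p : V.f.Dom, (p.1.length : ℝ) * boltzmann T p.1
            - ∑ p ∈ D m, (p.1.length : ℝ) * boltzmann T p.1 ∧
        ∀ p, p ∉ D m → Efun V T + 1 ≤ p.1.length ∧
          (p.1.length - Efun V T) * boltzmann T p.1 ≤
          Efun V T * ∑ p ∈ D m, boltzmann T p.1
            - ∑ p ∈ D m, (p.1.length : ℝ) * boltzmann T p.1) ∧
      Tendsto (fun m => Efun V T * ∑ p ∈ D m, boltzmann T p.1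
        - ∑ p ∈ D m, (p.1.length : ℝ) * boltzmann T p.1) atTop (𝓝 0) := by
  classical
  set E := Efun V T with hE
  have hE0 : 0 ≤ E := Efun_nonneg
  have hb := summable_b (V := V) hT
  have hlb := summable_lb (V := V) hT
  have hZ : 0 < Zfun V T := Zfun_pos hT
  have hEZ : E * Zfun V T = ∑' p : V.f.Dom, (p.1.length : ℝ) * boltzmann T p.1 := by
    rw [hE, Efun]; field_simp
  have hbpos : ∀ p : V.f.Dom, 0 < boltzmann T p.1 := fun p => by unfold boltzmann; positivity
  have hDt := finset_tendsto hD hDe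
  have hZt : Tendsto (fun m => ∑ p ∈ D m, boltzmann T p.1) atTop (𝓝 (Zfun V T)) :=
    hb.hasSum.comp hDt
  have hWt : Tendsto (fun m => ∑ p ∈ D m, (p.1.length : ℝ) * boltzmann T p.1) atTop
      (𝓝 (E * Zfun V T)) := by
    rw [hEZ]; exact hlb.hasSum.comp hDt
  -- short programs
  obtain ⟨N, hN⟩ := exists_nat_gt (E + 1)
  have hfin : {p : V.f.Dom | p.1.length < N}.Finite :=
    (List.finite_length_lt Bool N).preimage Subtype.val_injective.injOn
  have hev1 : ∀ᶠ m in atTop, hfin.toFinset ≤ D m := hDt.eventually_ge_atTop _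
  have hev2 : ∀ᶠ m in atTop, Zfun V T / 2 < ∑ p ∈ D m, boltzmann T p.1 :=
    hZt.eventually_const_lt (by linarith)
  obtain ⟨m0, hm0⟩ := eventually_atTop.1 (hev1.and hev2)
  refine ⟨m0, Zfun V T / 2, by linarith, ?_, ?_⟩
  · intro m hm
    obtain ⟨h1, h2⟩ := hm0 m hm
    have hlen : ∀ p, p ∉ D m → E + 1 ≤ p.1.length := by
      intro p hp
      by_contra hlt
      refine hp (h1 (hfin.mem_toFinset.2 ?_))
      have : (p.1.length : ℝ) < N := by linarith
      exact_mod_cast this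
    have hF : Summable fun p : V.f.Dom => ((p.1.length : ℝ) - E) * boltzmann T p.1 := by
      simp only [sub_mul]
      exact hlb.sub (hb.mul_left E)
    have hFt : ∑' p : V.f.Dom, ((p.1.length : ℝ) - E) * boltzmann T p.1 = 0 := by
      simp only [sub_mul]
      rw [hlb.tsum_sub (hb.mul_left E), tsum_mul_left, ← hEZ]
      simp [Zfun]
    have hFs : ∀ s : Finset V.f.Dom, ∑ p ∈ s, ((p.1.length : ℝ) - E) * boltzmann T p.1 =
        ∑ p ∈ s, (p.1.length : ℝ) * boltzmann T p.1 - E * ∑ p ∈ s, boltzmann T p.1 := by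
      intro s
      simp only [sub_mul]
      rw [Finset.sum_sub_distrib, Finset.mul_sum]
    have hnn : ∀ p, p ∉ D m → 0 ≤ ((p.1.length : ℝ) - E) * boltzmann T p.1 := by
      intro p hp
      have := hlen p hp
      exact mul_nonneg (by linarith) (hbpos p).le
    refine ⟨h2.le, ?_, ?_, ?_⟩
    · have := hF.sum_le_tsum (D m) hnn
      rw [hFt, hFs] at this
      linarith
    · rw [← hEZ]
      have := hb.sum_le_tsum (D m) (fun p _ => (hbpos p).le)
      have := mul_le_mul_of_nonneg_left this hE0
      unfold Zfun
      linarith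
    · intro p hp
      refine ⟨hlen p hp, ?_⟩
      have := hF.sum_le_tsum (insert p (D m)) (fun q hq => hnn q fun h => hq (Finset.mem_insert_of_mem h))
      rw [Finset.sum_insert hp, hFt, hFs] at this
      linarith
  · have := (hZt.const_mul E).sub hWt
    rwa [sub_self] at this
end


theorem bval_firstBits (α : ℝ) (n : ℕ) : (bval (firstBits α n) : ℤ) = ⌊(α - ⌊α⌋) * 2 ^ n⌋ := by
  induction n with
  | zero =>
    simp [firstBits, bval]
  | succ n ih =>
    have h1 : firstBits α (n + 1) = firstBits α n ++ [bitOf α n] := by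
      simp [firstBits, List.range_succ]
    rw [h1, bval_append]
    push_cast
    rw [ih, bitOf]
    set y := (α - ⌊α⌋) * 2 ^ n with hy
    have h2 : (α - ⌊α⌋) * 2 ^ (n + 1) = 2 * y := by rw [hy]; ring
    rw [h2]
    have h3 : 2 * ⌊y⌋ ≤ ⌊2 * y⌋ := by
      rw [Int.le_floor]; push_cast
      have := Int.floor_le y
      linarith
    have h4 : ⌊2 * y⌋ < 2 * ⌊y⌋ + 2 := by
      rw [Int.floor_lt]; push_cast
      have := Int.lt_floor_add_one y
      linarith
    rcases Int.emod_two_eq_zero_or_one ⌊2 * y⌋ with h | h <;> simp [h] <;> omega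

theorem bval_firstBits' {α : ℝ} (hα : 0 ≤ α) (n : ℕ) :
    bval (firstBits α n) + ⌊α⌋₊ * 2 ^ n = ⌊α * 2 ^ n⌋₊ := by
  have h := bval_firstBits α n
  have h1 : (⌊α⌋₊ : ℤ) = ⌊α⌋ := Int.natCast_floor_eq_floor hα
  have h2 : ((⌊α * 2 ^ n⌋₊ : ℕ) : ℤ) = ⌊α * 2 ^ n⌋ := Int.natCast_floor_eq_floor (by positivity)
  have h3 : α * 2 ^ n = (α - ⌊α⌋) * 2 ^ n + ((⌊α⌋ * 2 ^ n : ℤ) : ℝ) := by push_cast; ring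
  have : ((bval (firstBits α n) + ⌊α⌋₊ * 2 ^ n : ℕ) : ℤ) = (⌊α * 2 ^ n⌋₊ : ℕ) := by
    rw [h2, h3, Int.floor_add_intCast]
    push_cast
    rw [h, h1]
  exact_mod_cast this

def toBits (n a : ℕ) : List Bool := (List.range n).map fun i => decide (a / 2 ^ (n - 1 - i) % 2 = 1)

theorem firstBits_eq_toBits {α : ℝ} (hα : 0 ≤ α) (n : ℕ) : firstBits α n = toBits n ⌊α * 2 ^ n⌋₊ := by
  refine List.map_congr_left fun i hi => ?_
  rw [List.mem_range] at hi
  have h1 : ⌊α * 2 ^ n⌋₊ / 2 ^ (n - 1 - i) = ⌊α * 2 ^ (i + 1)⌋₊ := by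
    have := Nat.floor_div_natCast (α * 2 ^ n) (2 ^ (n - 1 - i))
    rw [← this]
    congr 1
    have h2 : n = (i + 1) + (n - 1 - i) := by omega
    rw [div_eq_iff (by positivity)]
    push_cast
    rw [mul_assoc, ← pow_add, ← h2]
  rw [h1, bitOf]
  have h2 : ((⌊α * 2 ^ (i + 1)⌋₊ : ℕ) : ℤ) = ⌊α * 2 ^ (i + 1)⌋ := Int.natCast_floor_eq_floor (by positivity)
  have h3 : α * 2 ^ (i + 1) = (α - ⌊α⌋) * 2 ^ (i + 1) + ((⌊α⌋ * 2 ^ (i + 1) : ℤ) : ℝ) := by push_cast; ring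
  have h5 : ⌊α * 2 ^ (i + 1)⌋ = ⌊(α - ⌊α⌋) * 2 ^ (i + 1)⌋ + 2 * (⌊α⌋ * 2 ^ i) := by
    rw [h3, Int.floor_add_intCast]; ring
  rw [decide_eq_decide]
  omega

theorem computable_toBits : Computable₂ toBits := by
  have heq : Primrec₂ (fun a b : ℕ => decide (a = b)) := by
    obtain ⟨_, h⟩ := (Primrec.eq (α := ℕ))
    refine h.of_eq fun n => ?_
    simp only [decide_eq_decide]
  have h : Primrec fun z : ℕ × ℕ => toBits z.1 z.2 := by
    refine Primrec.list_map (Primrec.list_range.comp Primrec.fst) ?_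
    have hn : Primrec fun y : (ℕ × ℕ) × ℕ => 2 ^ (y.1.1 - 1 - y.2) :=
      primrec_nat_pow.comp (Primrec.const 2) (Primrec.nat_sub.comp
        (Primrec.nat_sub.comp (Primrec.fst.comp Primrec.fst) (Primrec.const 1)) Primrec.snd)
    exact heq.comp (Primrec.nat_mod.comp (Primrec.nat_div.comp (Primrec.snd.comp Primrec.fst) hn)
      (Primrec.const 2)) (Primrec.const 1)
  exact h.to_comp


theorem partial_search {α : Type*} [Primcodable α] {p : α → ℕ → Bool} (hp : Computable₂ p) :
    ∃ f : α →. ℕ, Partrec f ∧ (∀ a, ∀ k ∈ f a, p a k = true) ∧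
      (∀ a k, p a k = true → ∃ k', k' ∈ f a) := by
  refine ⟨fun a => Nat.rfind (fun k => Part.some (p a k)), Partrec.rfind hp.partrec₂, ?_, ?_⟩
  · intro a k hk
    have := Nat.rfind_spec hk
    exact (Part.mem_some_iff.1 this).symm
  · intro a k hk
    have : (Nat.rfind (fun k => (Part.some (p a k) : Part Bool))).Dom :=
      Nat.rfind_dom.2 ⟨k, by simp [hk], fun _ => trivial⟩
    exact Part.dom_iff_mem.1 this

theorem len_growth {T : ℝ} (hT : 0 < T) (E C B : ℝ) :
    ∃ N : ℕ, ∀ n : ℕ, N ≤ n → ∀ l : ℕ, E + 1 ≤ l →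
      2 ^ n * (((l : ℝ) - E) * (2 : ℝ) ^ (-(l : ℝ) / T)) ≤ C → T * n + B ≤ l := by
  set L : ℝ := E + C * (2 : ℝ) ^ (B / T) with hL
  obtain ⟨N, hN⟩ := pow_unbounded_of_one_lt (C * (2 : ℝ) ^ (L / T)) (one_lt_two)
  refine ⟨N, fun n hn l hl h => ?_⟩
  by_contra hlt
  push Not at hlt
  have h2n : (2 : ℝ) ^ n = (2 : ℝ) ^ (n : ℝ) := (Real.rpow_natCast _ _).symm
  have h1 : (2 : ℝ) ^ (-(B / T)) ≤ 2 ^ n * (2 : ℝ) ^ (-(l : ℝ) / T) := by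
    rw [h2n, ← Real.rpow_add (by norm_num)]
    refine Real.rpow_le_rpow_of_exponent_le (by norm_num) ?_
    have : (l : ℝ) / T ≤ n + B / T := by
      rw [div_le_iff₀ hT, add_mul, div_mul_cancel₀ _ hT.ne']
      linarith
    rw [neg_div]; linarith
  have h2 : (l : ℝ) ≤ L := by
    have h3 : ((l : ℝ) - E) * (2 : ℝ) ^ (-(B / T)) ≤ C := by
      have := mul_le_mul_of_nonneg_left h1 (show 0 ≤ (l : ℝ) - E by linarith)
      linarith
    rw [Real.rpow_neg (by norm_num), ← div_eq_mul_inv, div_le_iff₀ (by positivity)] at h3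
    linarith
  have h3 : (2 : ℝ) ^ (-(L / T)) ≤ (2 : ℝ) ^ (-(l : ℝ) / T) := by
    refine Real.rpow_le_rpow_of_exponent_le (by norm_num) ?_
    rw [neg_div, neg_le_neg_iff]
    exact div_le_div_of_nonneg_right h2 hT.le
  have h4 : (2 : ℝ) ^ n * (2 : ℝ) ^ (-(L / T)) ≤ C := by
    refine le_trans ?_ h
    refine mul_le_mul_of_nonneg_left (h3.trans ?_) (by positivity)
    exact le_mul_of_one_le_left (by positivity) (by linarith)
  rw [Real.rpow_neg (by norm_num), ← div_eq_mul_inv, div_le_iff₀ (by positivity)] at h4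
  have h5 : (2 : ℝ) ^ N ≤ 2 ^ n := pow_le_pow_right₀ (by norm_num) hn
  linarith

theorem randomness {U : Computer} (hU : Optimal U) {V : Computer} (hV : Optimal V)
    {T : ℝ} (hT : T ∈ Set.Ioo (0 : ℝ) 1) (hTcomp : ComputableReal T) :
    ChaitinTRandom U T (Efun V T) := by
  obtain ⟨halt, Bf, D, hh, hBf, hD, hDe, hst, hout⟩ := exists_enum V
  obtain ⟨fZ, hfZ, hfZe⟩ := ucomp_stage hh computable_plen (ucomp_b hT.1 hTcomp)
  obtain ⟨fW, hfW, hfWe⟩ := ucomp_stage hh computable_plen (ucomp_mul_len (ucomp_b hT.1 hTcomp))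
  obtain ⟨m0, z0, hz0, hm0, hRt⟩ := analysis hT hD hDe
  have hE0 : 0 ≤ Efun V T := Efun_nonneg
  set E := Efun V T with hE
  simp only [hst] at hfZe hfWe
  change ∀ m K, |(fZ m K : ℝ) - 2 ^ K * ∑ p ∈ D m, boltzmann T p.1| ≤ 2 at hfZe
  change ∀ m K, |(fW m K : ℝ) - 2 ^ K * ∑ p ∈ D m, (p.1.length : ℝ) * boltzmann T p.1| ≤ 2 at hfWe
  have hZle : ∀ m, ∑ p ∈ D m, boltzmann T p.1 ≤ Zfun V T := fun m =>
    (summable_b hT).sum_le_tsum (D m) (fun p _ => by unfold boltzmann; positivity)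
  set Z : ℕ → ℝ := fun m => ∑ p ∈ D m, boltzmann T p.1 with hZdef
  set W : ℕ → ℝ := fun m => ∑ p ∈ D m, (p.1.length : ℝ) * boltzmann T p.1 with hWdef
  change ∀ m K, |(fZ m K : ℝ) - 2 ^ K * Z m| ≤ 2 at hfZe
  change ∀ m K, |(fW m K : ℝ) - 2 ^ K * W m| ≤ 2 at hfWe
  change Tendsto (fun m => E * Z m - W m) atTop (𝓝 0) at hRt
  change ∀ m, Z m ≤ Zfun V T at hZle
  obtain ⟨Bc, hBc⟩ := exists_nat_ge (3 + 2 * E)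
  let P : List Bool → ℕ → Bool := fun s k =>
    decide ((bval s + ⌊E⌋₊ * 2 ^ s.length) * fZ (m0 + k) s.length ≤
      2 ^ s.length * fW (m0 + k) s.length + Bc * 2 ^ s.length)
  have hP : Computable₂ P := by
    have hn : Computable fun z : List Bool × ℕ => z.1.length := Computable.list_length.comp Computable.fst
    have h2 : Computable fun z : List Bool × ℕ => 2 ^ z.1.length :=
      computable_pow.comp (Computable.const 2) hn
    have hm : Computable fun z : List Bool × ℕ => m0 + z.2 :=
      computable_add.comp (Computable.const m0) Computable.snd
    exact computable_le.comp
      (computable_mul.comp (computable_add.comp (computable_bval.comp Computable.fst)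
        (computable_mul.comp (Computable.const _) h2)) (hfZ.comp hm hn))
      (computable_add.comp (computable_mul.comp h2 (hfW.comp hm hn))
        (computable_mul.comp (Computable.const _) h2))
  obtain ⟨f, hf, hf1, hf2⟩ := partial_search hP
  let g : List Bool →. List Bool := fun s => (f s).map fun k => List.replicate (Bf (m0 + k)) false
  have hg : Partrec g := by
    refine hf.map ?_
    have : Primrec fun n : ℕ => List.replicate n false := by
      refine (Primrec.list_map Primrec.list_range (Primrec₂.const false)).of_eq fun n => ?_
      simp
    exact this.to_comp.comp (hBf.comp (computable_add.comp (Computable.const m0) Computable.snd))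
  obtain ⟨d, hd⟩ := complexity_comp hU hV hg
  -- behaviour on initial segments
  set C : ℝ := 2 * E + Zfun V T + 4 + Bc with hC
  have hZ0 : 0 < Zfun V T := Zfun_pos hT
  have hC0 : 0 ≤ C := by positivity
  have hkey : ∀ n, ∃ l : ℕ, E + 1 ≤ l ∧
      2 ^ n * (((l : ℝ) - E) * (2 : ℝ) ^ (-(l : ℝ) / T)) ≤ C ∧
      l ≤ complexity U (firstBits E n) + d := by
    intro n
    set s := firstBits E n with hs
    have hsl : s.length = n := by simp [hs, firstBits]
    have ha : bval s + ⌊E⌋₊ * 2 ^ n = ⌊E * 2 ^ n⌋₊ := bval_firstBits' hE0 n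
    have h2n : (0 : ℝ) < 2 ^ n := by positivity
    have ha1 : (⌊E * 2 ^ n⌋₊ : ℝ) ≤ E * 2 ^ n := Nat.floor_le (by positivity)
    have ha2 : E * 2 ^ n < (⌊E * 2 ^ n⌋₊ : ℝ) + 1 := Nat.lt_floor_add_one _
    have hPs : ∀ k, P s k = true ↔ (⌊E * 2 ^ n⌋₊ : ℝ) * fZ (m0 + k) n ≤
        2 ^ n * fW (m0 + k) n + Bc * 2 ^ n := by
      intro k
      simp only [P, hsl, ha, decide_eq_true_eq]
      exact_mod_cast Iff.rfl
    -- termination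
    have hterm : ∃ k, P s k = true := by
      have hev : ∀ᶠ m in atTop, E * Z m - W m < 1 / 2 ^ n := hRt.eventually_lt_const (by positivity)
      obtain ⟨m1, hm1⟩ := eventually_atTop.1 hev
      refine ⟨m1, (hPs _).2 ?_⟩
      have h1 := hm1 (m0 + m1) (by omega)
      rw [lt_div_iff₀ h2n] at h1
      have h2 := abs_le.1 (hfZe (m0 + m1) n)
      have h3 := abs_le.1 (hfWe (m0 + m1) n)
      have h4 : (⌊E * 2 ^ n⌋₊ : ℝ) * fZ (m0 + m1) n ≤ E * 2 ^ n * (2 ^ n * Z (m0 + m1) + 2) :=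
        mul_le_mul ha1 (by linarith) (by positivity) (by positivity)
      have h5 : (2 : ℝ) ^ n * (2 ^ n * W (m0 + m1) - 2) ≤ 2 ^ n * fW (m0 + m1) n :=
        mul_le_mul_of_nonneg_left (by linarith) h2n.le
      have h6 := mul_le_mul_of_nonneg_left h1.le h2n.le
      have h7 := mul_le_mul_of_nonneg_left hBc h2n.le
      nlinarith
    obtain ⟨k0, hk0⟩ := hterm
    obtain ⟨k, hk⟩ := hf2 s k0 hk0
    have h1 := (hPs k).1 (hf1 s k hk)
    set m := m0 + k with hm
    have hy : List.replicate (Bf m) false ∈ g s := Part.mem_map _ hk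
    have hcomp := hd s _ hy
    obtain ⟨p, hp, hpl⟩ := exists_prog_min hV (List.replicate (Bf m) false)
    have hpd : p ∈ V.f.Dom := Part.dom_iff_mem.2 ⟨_, hp⟩
    have hpD : (⟨p, hpd⟩ : V.f.Dom) ∉ D m := by
      intro hmem
      have := hout m _ hmem _ hp
      simp at this
    obtain ⟨-, -, -, hm4⟩ := hm0 m (by omega)
    obtain ⟨hp1, hp2⟩ := hm4 _ hpD
    refine ⟨p.length, hp1, ?_, by rw [hpl]; exact hcomp⟩
    change ((p.length : ℝ) - E) * (2 : ℝ) ^ (-(p.length : ℝ) / T) ≤ E * Z m - W m at hp2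
    refine (mul_le_mul_of_nonneg_left hp2 h2n.le).trans ?_
    have h2 := abs_le.1 (hfZe m n)
    have h3 := abs_le.1 (hfWe m n)
    have h5 : (2 : ℝ) ^ n * fW m n ≤ 2 ^ n * (2 ^ n * W m + 2) :=
      mul_le_mul_of_nonneg_left (by linarith) h2n.le
    have h6 : (E * 2 ^ n - 1) * fZ m n ≤ (⌊E * 2 ^ n⌋₊ : ℝ) * fZ m n :=
      mul_le_mul_of_nonneg_right (by linarith) (by positivity)
    have h7 : E * 2 ^ n * (2 ^ n * Z m - 2) ≤ E * 2 ^ n * fZ m n :=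
      mul_le_mul_of_nonneg_left (by linarith) (by positivity)
    have h8 : (fZ m n : ℝ) ≤ 2 ^ n * (Zfun V T + 2) := by
      have : (2 : ℝ) ^ n * Z m ≤ 2 ^ n * Zfun V T := mul_le_mul_of_nonneg_left (hZle m) h2n.le
      have h1n : (1 : ℝ) ≤ 2 ^ n := one_le_pow₀ (by norm_num)
      linarith
    have h9 : (2 : ℝ) ^ n * (2 ^ n * (E * Z m - W m)) ≤ 2 ^ n * C := by
      rw [hC]; linarith
    exact le_of_mul_le_mul_left h9 h2n
  rw [ChaitinTRandom, tendsto_atTop]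
  intro b
  obtain ⟨N, hN⟩ := len_growth hT.1 E C (b + d)
  filter_upwards [eventually_ge_atTop N] with n hn
  obtain ⟨l, hl1, hl2, hl3⟩ := hkey n
  have := hN n hn l hl1 hl2
  have h3 : (l : ℝ) ≤ complexity U (firstBits E n) + d := by exact_mod_cast hl3
  linarith


theorem tail_lb (V : Computer) {T t : ℝ} (hT : T ∈ Set.Ioo (0 : ℝ) 1) (hTt : T < t) (ht : t < 1) :
    ∃ C : ℝ, 0 < C ∧ ∀ (s : Finset V.f.Dom) (ε : ℝ), 0 < ε →
      ∑' p : V.f.Dom, (1 / 2 : ℝ) ^ p.1.length - ∑ p ∈ s, (1 / 2 : ℝ) ^ p.1.length ≤ ε →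
      ∑' p : V.f.Dom, (p.1.length : ℝ) * boltzmann T p.1
        - ∑ p ∈ s, (p.1.length : ℝ) * boltzmann T p.1 ≤ C * ε ^ (1 / t) := by
  classical
  obtain ⟨C, hC, hCl⟩ := len_bound hT.1 hTt
  have ht0 : 0 < t := hT.1.trans hTt
  refine ⟨C, hC, fun s ε hε hs => ?_⟩
  have hr : 0 ≤ 1 / t - 1 := by
    rw [sub_nonneg, le_div_iff₀ ht0]; linarith
  have h1 : ∀ p, p ∉ s → (p.1.length : ℝ) * boltzmann T p.1 ≤
      (C * ε ^ (1 / t - 1)) * (1 / 2 : ℝ) ^ p.1.length := by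
    intro p hp
    have h2 : (1 / 2 : ℝ) ^ p.1.length ≤ ε := by
      have := (summable_half V).sum_le_tsum (insert p s) (fun q _ => by positivity)
      rw [Finset.sum_insert hp] at this
      linarith
    have h3 : ((1 / 2 : ℝ) ^ p.1.length) ^ (1 / t) ≤ ε ^ (1 / t - 1) * (1 / 2 : ℝ) ^ p.1.length := by
      have h4 : 1 / t = (1 / t - 1) + 1 := by ring
      conv_lhs => rw [h4]
      rw [Real.rpow_add (by positivity), Real.rpow_one]
      exact mul_le_mul_of_nonneg_right (Real.rpow_le_rpow (by positivity) h2 hr) (by positivity)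
    have h5 : (2 : ℝ) ^ (-(p.1.length : ℝ) / t) = ((1 / 2 : ℝ) ^ p.1.length) ^ (1 / t) := by
      rw [half_eq, ← Real.rpow_mul (by norm_num)]
      congr 1
      ring
    refine (hCl p.1.length).trans ?_
    rw [h5, mul_assoc]
    exact mul_le_mul_of_nonneg_left h3 hC.le
  refine (tail_bound (summable_lb hT) (summable_half V) s h1).trans ?_
  refine (mul_le_mul_of_nonneg_left hs (by positivity)).trans ?_
  rw [mul_assoc]
  refine mul_le_mul_of_nonneg_left (le_of_eq ?_) hC.le
  conv_lhs => rw [← Real.rpow_one ε, ← Real.rpow_mul hε.le, ← Real.rpow_add hε]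
  congr 1
  ring

set_option maxHeartbeats 1600000 in
theorem compress_aux {U : Computer} (hU : Optimal U) (V : Computer)
    {T : ℝ} (hT : T ∈ Set.Ioo (0 : ℝ) 1) (hTcomp : ComputableReal T) {u v r : ℕ} (hv : 0 < v)
    (hTu : T < (u : ℝ) / v) (huv : u < v) (hr : r < v) :
    ∃ c : ℕ, ∀ j, complexity U (firstBits (Efun V T) (v * j + r)) ≤ j + u * (j + 1) + c := by
  obtain ⟨halt, Bf, D, hh, hBf, hD, hDe, hst, hout⟩ := exists_enum V
  obtain ⟨fZ, hfZ, hfZe⟩ := ucomp_stage hh computable_plen (ucomp_b hT.1 hTcomp)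
  obtain ⟨fW, hfW, hfWe⟩ := ucomp_stage hh computable_plen (ucomp_mul_len (ucomp_b hT.1 hTcomp))
  obtain ⟨fO, hfO, hfOe⟩ := ucomp_stage hh computable_plen ucomp_half
  obtain ⟨m0, z0, hz0, hm0, hRt⟩ := analysis hT hD hDe
  have hv' : (0 : ℝ) < v := by exact_mod_cast hv
  have hu' : (0 : ℝ) < u := by
    by_contra h
    have : (u : ℝ) / v ≤ 0 := div_nonpos_of_nonpos_of_nonneg (by linarith) hv'.le
    linarith [hT.1]
  obtain ⟨C, hC, hCt⟩ := tail_lb V hT hTu (by rw [div_lt_one hv']; exact_mod_cast huv)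
  have hE0 : 0 ≤ Efun V T := Efun_nonneg
  set E := Efun V T with hE
  simp only [hst] at hfZe hfWe hfOe
  set Z : ℕ → ℝ := fun m => ∑ p ∈ D m, boltzmann T p.1 with hZdef
  set W : ℕ → ℝ := fun m => ∑ p ∈ D m, (p.1.length : ℝ) * boltzmann T p.1 with hWdef
  set O : ℕ → ℝ := fun m => ∑ p ∈ D m, (1 / 2 : ℝ) ^ p.1.length with hOdef
  change ∀ m K, |(fZ m K : ℝ) - 2 ^ K * Z m| ≤ 2 at hfZe
  change ∀ m K, |(fW m K : ℝ) - 2 ^ K * W m| ≤ 2 at hfWe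
  change ∀ m K, |(fO m K : ℝ) - 2 ^ K * O m| ≤ 2 at hfOe
  set Om : ℝ := ∑' p : V.f.Dom, (1 / 2 : ℝ) ^ p.1.length with hOm
  have hOm1 : Om ≤ 1 := (summable_half V).tsum_le_of_sum_le (kraft V)
  have hOm0 : 0 ≤ Om := tsum_nonneg fun p => by positivity
  have hOt : Tendsto O atTop (𝓝 Om) := (summable_half V).hasSum.comp (finset_tendsto hD hDe)
  -- constants
  obtain ⟨k0, hk0⟩ := pow_unbounded_of_one_lt (4 / z0) (one_lt_two (α := ℝ))
  rw [div_lt_iff₀ hz0] at hk0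
  set C2 : ℝ := C * (6 : ℝ) ^ (1 / ((u : ℝ) / v)) with hC2
  have hC2pos : 0 < C2 := by positivity
  obtain ⟨Dc, hDc⟩ := exists_nat_ge (2 * (2 ^ k0 * C2 + 2 + 2 * E) / (2 ^ k0 * z0) + 2)
  set c0 := 2 * Dc + 1 with hc0
  have hc0lt : 2 * Dc < 2 ^ c0 := lt_trans (by omega) (Nat.lt_two_pow_self)
  let P : ℕ × ℕ → ℕ → Bool := fun z i =>
    decide (z.2 ≤ fO (m0 + i) (u * (z.1 + 1)) + 3)
  have hk1 : Computable fun j : ℕ => u * (j + 1) :=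
    computable_mul.comp (Computable.const u) Computable.succ
  have hn1 : Computable fun j : ℕ => v * j + r :=
    computable_add.comp (computable_mul.comp (Computable.const v) Computable.id) (Computable.const r)
  have hmi : Computable fun y : (ℕ × ℕ) × ℕ => m0 + y.2 :=
    computable_add.comp (Computable.const m0) Computable.snd
  have hj : Computable fun y : (ℕ × ℕ) × ℕ => y.1.1 := Computable.fst.comp Computable.fst
  have hx : Computable fun y : (ℕ × ℕ) × ℕ => y.1.2 := Computable.snd.comp Computable.fst
  have hP : Computable₂ P :=
    computable_le.comp hx
      (computable_add.comp (hfO.comp hmi (hk1.comp hj)) (Computable.const 3))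
  obtain ⟨f, hf, hf1, hf2⟩ := partial_search hP
  let Q : ℕ → ℕ → ℕ := fun n m => 2 ^ n * fW m (n + k0) / fZ m (n + k0)
  have hQ : Computable₂ Q := by
    have hK : Computable fun y : ℕ × ℕ => y.1 + k0 :=
      computable_add.comp Computable.fst (Computable.const k0)
    exact computable_div.comp (computable_mul.comp (computable_pow.comp (Computable.const 2) Computable.fst)
      (hfW.comp Computable.snd hK)) (hfZ.comp Computable.snd hK)
  let g : ℕ × ℕ →. List Bool := fun z => (f (z.1, z.2 / 2 ^ c0)).map fun i =>
    toBits (v * z.1 + r) (Q (v * z.1 + r) (m0 + i) + z.2 % 2 ^ c0 - Dc)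
  have hg : Partrec g := by
    have hz : Computable fun z : ℕ × ℕ => (z.1, z.2 / 2 ^ c0) :=
      Computable.fst.pair (computable_div.comp Computable.snd (Computable.const _))
    refine (hf.comp hz).map ?_
    exact computable_toBits.comp (hn1.comp hj) (computable_sub.comp (computable_add.comp
      (hQ.comp (hn1.comp hj) hmi) (computable_mod.comp hx (Computable.const _))) (Computable.const Dc))
  have hL : Computable fun j => u * (j + 1) + (1 + c0) := computable_add.comp hk1 (Computable.const _)
  obtain ⟨d, hd⟩ := complexity_param hU hg hL
  refine ⟨1 + c0 + d, fun j => ?_⟩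
  set k := u * (j + 1) with hk
  set n := v * j + r with hn
  have h2k : (0 : ℝ) < 2 ^ k := by positivity
  have h2n : (0 : ℝ) < 2 ^ n := by positivity
  set A := ⌊Om * 2 ^ k⌋₊ with hA
  have hA1 : (A : ℝ) ≤ Om * 2 ^ k := Nat.floor_le (by positivity)
  have hA2 : Om * 2 ^ k < (A : ℝ) + 1 := Nat.lt_floor_add_one _
  have hA3 : A ≤ 2 ^ k := by
    have : (A : ℝ) ≤ 2 ^ k := hA1.trans (by nlinarith)
    exact_mod_cast this
  set a := ⌊E * 2 ^ n⌋₊ with ha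
  have ha1 : (a : ℝ) ≤ E * 2 ^ n := Nat.floor_le (by positivity)
  have ha2 : E * 2 ^ n < (a : ℝ) + 1 := Nat.lt_floor_add_one _
  -- quality of the approximation found
  have hmain : ∀ i, A ≤ fO (m0 + i) k + 3 → a ≤ Q n (m0 + i) + Dc ∧ Q n (m0 + i) ≤ a + Dc := by
    intro i hi
    set m := m0 + i with hm
    have hi' : (A : ℝ) ≤ fO m k + 3 := by exact_mod_cast hi
    obtain ⟨g1, g2, g3, -⟩ := hm0 m (by omega)
    change z0 ≤ Z m at g1
    change 0 ≤ E * Z m - W m at g2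
    have e1 := abs_le.1 (hfOe m k)
    have htau : Om - O m ≤ 6 / 2 ^ k := by
      rw [le_div_iff₀ h2k]; linarith
    have hN := g3.trans (hCt (D m) _ (by positivity) htau)
    change E * Z m - W m ≤ C * (6 / 2 ^ k) ^ (1 / ((u : ℝ) / v)) at hN
    have hpow : ((2 : ℝ) ^ k) ^ (1 / ((u : ℝ) / v)) = 2 ^ (v * (j + 1)) := by
      rw [← Real.rpow_natCast, ← Real.rpow_mul (by norm_num), ← Real.rpow_natCast]
      congr 1
      rw [hk]; push_cast
      field_simp
    have hR : (2 : ℝ) ^ n * (E * Z m - W m) ≤ C2 := by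
      rw [Real.div_rpow (by norm_num) (by positivity), hpow] at hN
      have hle : (2 : ℝ) ^ n ≤ 2 ^ (v * (j + 1)) :=
        pow_le_pow_right₀ (by norm_num) (by rw [hn, mul_add]; omega)
      calc (2 : ℝ) ^ n * (E * Z m - W m) ≤ 2 ^ (v * (j + 1)) * (E * Z m - W m) :=
            mul_le_mul_of_nonneg_right hle g2
        _ ≤ 2 ^ (v * (j + 1)) * (C * (6 ^ (1 / ((u : ℝ) / v)) / 2 ^ (v * (j + 1)))) :=
            mul_le_mul_of_nonneg_left hN (by positivity)
        _ = C2 := by rw [hC2]; field_simp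
    have e2 := abs_le.1 (hfZe m (n + k0))
    have e3 := abs_le.1 (hfWe m (n + k0))
    set K := n + k0 with hK
    have hKp : (2 : ℝ) ^ K = 2 ^ n * 2 ^ k0 := pow_add _ _ _
    have h1n : (1 : ℝ) ≤ 2 ^ n := one_le_pow₀ (by norm_num)
    have h1k : (0 : ℝ) < 2 ^ k0 := by positivity
    have hZlow : 2 ^ n * (2 ^ k0 * z0) / 2 ≤ (fZ m K : ℝ) := by
      have t1 : (2 : ℝ) ^ K * z0 ≤ 2 ^ K * Z m := mul_le_mul_of_nonneg_left g1 (by positivity)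
      have t2 : (4 : ℝ) ≤ 2 ^ n * (2 ^ k0 * z0) :=
        hk0.le.trans (le_mul_of_one_le_left (by positivity) h1n)
      rw [hKp] at t1 e2
      rw [mul_assoc] at t1
      linarith
    have hZpos : (0 : ℝ) < fZ m K := lt_of_lt_of_le (by positivity) hZlow
    have hdiff : |(fW m K : ℝ) - E * fZ m K| ≤ 2 ^ k0 * C2 + 2 + 2 * E := by
      have t1 : (2 : ℝ) ^ K * (E * Z m - W m) ≤ 2 ^ k0 * C2 := by
        rw [hKp, mul_comm ((2 : ℝ) ^ n), mul_assoc]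
        exact mul_le_mul_of_nonneg_left hR h1k.le
      have t2 : 0 ≤ (2 : ℝ) ^ K * (E * Z m - W m) := mul_nonneg (by positivity) g2
      have t3 := mul_le_mul_of_nonneg_left e2.1 hE0
      have t4 := mul_le_mul_of_nonneg_left e2.2 hE0
      have t5 : 0 < 2 ^ k0 * C2 := by positivity
      rw [abs_le]
      constructor <;> linarith
    have hq : |2 ^ n * (fW m K : ℝ) / fZ m K - E * 2 ^ n| ≤
        2 * (2 ^ k0 * C2 + 2 + 2 * E) / (2 ^ k0 * z0) := by
      have t1 : 2 ^ n * (fW m K : ℝ) / fZ m K - E * 2 ^ n =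
          2 ^ n * ((fW m K : ℝ) - E * fZ m K) / fZ m K := by
        field_simp
      rw [t1, abs_div, abs_mul, abs_of_pos h2n, abs_of_pos hZpos, div_le_div_iff₀ hZpos (by positivity)]
      have t2 : 0 ≤ 2 ^ k0 * C2 + 2 + 2 * E := by positivity
      calc 2 ^ n * |(fW m K : ℝ) - E * fZ m K| * (2 ^ k0 * z0)
          ≤ 2 ^ n * (2 ^ k0 * C2 + 2 + 2 * E) * (2 ^ k0 * z0) := by gcongr
        _ = 2 * (2 ^ k0 * C2 + 2 + 2 * E) * (2 ^ n * (2 ^ k0 * z0) / 2) := by ring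
        _ ≤ _ := mul_le_mul_of_nonneg_left hZlow (by positivity)
    have hq1 : (Q n m : ℝ) ≤ 2 ^ n * (fW m K : ℝ) / fZ m K := by
      have := Nat.cast_div_le (α := ℝ) (m := 2 ^ n * fW m K) (n := fZ m K)
      simpa [Q] using this
    have hq2 : 2 ^ n * (fW m K : ℝ) / fZ m K < (Q n m : ℝ) + 1 := by
      have hpos : 0 < fZ m K := by exact_mod_cast hZpos
      have := Nat.lt_mul_div_succ (2 ^ n * fW m K) hpos
      rw [div_lt_iff₀ hZpos]
      have h' : ((2 ^ n * fW m K : ℕ) : ℝ) < ((fZ m K * (2 ^ n * fW m K / fZ m K + 1) : ℕ) : ℝ) := by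
        exact_mod_cast this
      push_cast at h'
      change 2 ^ n * (fW m K : ℝ) < ((2 ^ n * fW m K / fZ m K : ℕ) + 1) * (fZ m K : ℝ)
      rw [mul_comm _ (fZ m K : ℝ)]
      exact h'
    have hq' := abs_le.1 hq
    constructor
    · have : (a : ℝ) ≤ Q n m + Dc := by linarith
      exact_mod_cast this
    · have : (Q n m : ℝ) ≤ a + Dc := by linarith
      exact_mod_cast this
  -- termination
  have hterm : ∃ i, A ≤ fO (m0 + i) k + 3 := by
    have hev : ∀ᶠ m in atTop, Om - 1 / 2 ^ k < O m :=
      hOt.eventually_const_lt (by linarith [show (0 : ℝ) < 1 / 2 ^ k by positivity])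
    obtain ⟨m1, hm1⟩ := eventually_atTop.1 hev
    refine ⟨m1, ?_⟩
    have h1 := hm1 (m0 + m1) (by omega)
    have h2 := abs_le.1 (hfOe (m0 + m1) k)
    have h3 := mul_lt_mul_of_pos_left h1 h2k
    rw [mul_sub, mul_one_div_cancel h2k.ne'] at h3
    have : (A : ℝ) ≤ fO (m0 + m1) k + 3 := by linarith
    exact_mod_cast this
  obtain ⟨i0, hi0⟩ := hterm
  obtain ⟨i, hi⟩ := hf2 (j, A) i0 (by simpa [P] using hi0)
  have hi1 : A ≤ fO (m0 + i) k + 3 := by simpa [P] using hf1 _ _ hi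
  obtain ⟨q1, q2⟩ := hmain i hi1
  set δ := a + Dc - Q n (m0 + i) with hδ
  have hδlt : δ < 2 ^ c0 := by omega
  have hdiv : (A * 2 ^ c0 + δ) / 2 ^ c0 = A := by
    rw [mul_comm, Nat.mul_add_div (by positivity), Nat.div_eq_of_lt hδlt, add_zero]
  have hmod : (A * 2 ^ c0 + δ) % 2 ^ c0 = δ := by
    rw [mul_comm, Nat.mul_add_mod, Nat.mod_eq_of_lt hδlt]
  have hxlt : A * 2 ^ c0 + δ < 2 ^ (k + (1 + c0)) := by
    have e1 : 2 ^ (k + (1 + c0)) = 2 * (2 ^ k * 2 ^ c0) := by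
      rw [pow_add, pow_add]; ring
    have e2 : A * 2 ^ c0 ≤ 2 ^ k * 2 ^ c0 := Nat.mul_le_mul_right _ hA3
    have e3 : 2 ^ c0 ≤ 2 ^ k * 2 ^ c0 := Nat.le_mul_of_pos_left _ (by positivity)
    rw [e1]
    omega
  have hmem : firstBits E n ∈ g (j, A * 2 ^ c0 + δ) := by
    refine (Part.mem_map_iff _).2 ⟨i, ?_, ?_⟩
    · simp only [hdiv]; exact hi
    · simp only [hmod]
      rw [firstBits_eq_toBits hE0]
      change toBits n (Q n (m0 + i) + δ - Dc) = toBits n a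
      congr 1
      omega
  have := hd j _ hxlt _ hmem
  omega


theorem compressible {U : Computer} (hU : Optimal U) (V : Computer)
    {T : ℝ} (hT : T ∈ Set.Ioo (0 : ℝ) 1) (hTcomp : ComputableReal T) :
    TCompressible U T (Efun V T) := by
  refine ⟨fun n => max 0 ((complexity U (firstBits (Efun V T) n) : ℝ) - T * n), ?_, ?_⟩
  · have hb : ∀ ε : ℝ, 0 < ε → ∃ c : ℝ, 0 ≤ c ∧ ∀ n : ℕ,
        (complexity U (firstBits (Efun V T) n) : ℝ) - T * n ≤ ε * n + c := by
      intro ε hε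
      obtain ⟨v, hv⟩ := exists_nat_gt (max (1 / (1 - T)) (2 / ε))
      obtain ⟨hv1, hv2⟩ := max_lt_iff.1 hv
      have h1T : 0 < 1 - T := by linarith [hT.2]
      have hv0 : (0 : ℝ) < v := lt_trans (by positivity) hv1
      have hvn : 0 < v := by exact_mod_cast hv0
      rw [div_lt_iff₀ h1T] at hv1
      rw [div_lt_iff₀ hε] at hv2
      have hTv : 0 ≤ T * v := mul_nonneg hT.1.le hv0.le
      set u := ⌊T * v⌋₊ + 1 with hu
      have hu1 : (u : ℝ) ≤ T * v + 1 := by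
        rw [hu]; push_cast
        linarith [Nat.floor_le hTv]
      have hu2 : T * v < u := by
        rw [hu]; push_cast; exact Nat.lt_floor_add_one _
      have huv : u < v := by
        have : (u : ℝ) < v := by linarith
        exact_mod_cast this
      have hc : ∀ r : Fin v, ∃ c : ℕ, ∀ j,
          complexity U (firstBits (Efun V T) (v * j + r)) ≤ j + u * (j + 1) + c := fun r =>
        compress_aux hU V hT hTcomp hvn (by rw [lt_div_iff₀ hv0]; exact hu2) huv r.2
      choose c hc using hc
      set c' : ℕ := ∑ r : Fin v, c r with hc'
      refine ⟨(T * v + 1) + c', by positivity, fun n => ?_⟩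
      set r : Fin v := ⟨n % v, Nat.mod_lt _ hvn⟩ with hr
      have h1 := hc r (n / v)
      have h2 : v * (n / v) + (r : ℕ) = n := Nat.div_add_mod n v
      rw [h2] at h1
      have h3 : c r ≤ c' := Finset.single_le_sum (f := c) (fun _ _ => Nat.zero_le _) (Finset.mem_univ r)
      have h4 : (complexity U (firstBits (Efun V T) n) : ℝ) ≤ (n / v : ℕ) + u * ((n / v : ℕ) + 1) + c' := by
        exact_mod_cast h1.trans (by omega)
      have h5 : ((n / v : ℕ) : ℝ) ≤ n / v := Nat.cast_div_le
      have h6 : (u : ℝ) * ((n / v : ℕ) + 1) ≤ (T * v + 1) * ((n : ℝ) / v + 1) :=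
        mul_le_mul hu1 (by linarith) (by positivity) (by linarith)
      have h7 : (T * v + 1) * ((n : ℝ) / v + 1) = T * n + (n : ℝ) / v + (T * v + 1) := by
        field_simp
      have h8 : 2 * ((n : ℝ) / v) ≤ ε * n := by
        rw [← mul_div_assoc, div_le_iff₀ hv0]
        have : (0 : ℝ) ≤ n := by positivity
        nlinarith
      linarith
    rw [Metric.tendsto_atTop]
    intro ε hε
    obtain ⟨c, hc0, hc⟩ := hb (ε / 2) (by positivity)
    obtain ⟨N, hN⟩ := exists_nat_gt (2 * c / ε)
    refine ⟨N + 1, fun n hn => ?_⟩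
    have hn0 : (0 : ℝ) < n := by exact_mod_cast (by omega : 0 < n)
    have hNn : (N : ℝ) ≤ n := by exact_mod_cast (by omega : N ≤ n)
    rw [Real.dist_eq, sub_zero, abs_of_nonneg (by positivity), div_lt_iff₀ hn0]
    have h1 : c < ε / 2 * n := by
      rw [div_lt_iff₀ hε] at hN
      nlinarith
    refine max_lt (by positivity) ?_
    have := hc n
    linarith
  · intro n _
    have := le_max_right 0 ((complexity U (firstBits (Efun V T) n) : ℝ) - T * n)
    linarith

/-- For optimal `V` and computable `T` with `0 < T < 1`, the
energy `E_V(T)` is a well-defined real (both series converge) that is Chaitin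
`T`-random and `T`-compressible. -/
theorem energy_partial_randomness
    (U : Computer) (hU : Optimal U) (V : Computer) (hV : Optimal V)
    (T : ℝ) (hT : T ∈ Set.Ioo (0 : ℝ) 1) (hTcomp : ComputableReal T) :
    Summable (fun p : V.f.Dom => boltzmann T p.1) ∧
    Summable (fun p : V.f.Dom => (p.1.length : ℝ) * boltzmann T p.1) ∧
    ChaitinTRandom U T (Efun V T) ∧ TCompressible U T (Efun V T) := by
  exact ⟨summable_b hT, summable_lb hT, randomness hU hV hT hTcomp, compressible hU V hT hTcomp⟩
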